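/- Let G be a connected simple graph with maximum degree at most 4 and suppose there is a list assignment L with |L(e)| ≥ 22 for every edge e such that G is not strongly L-edge-colorable but every proper subgraph of G is strongly L-edge-colorable (restricting L to its edges). Then G contains no cycle of length 5. -/

import Mathlib

/-- Two edges are "close" (distance at most 1): some endpoint of one equals,
or is adjacent to, some endpoint of the other. In a strong edge-coloring,
distinct close edges must get distinct colors. -/
def EdgeClose {V : Type*} (G : SimpleGraph V) (e₁ e₂ : Sym2 V) : Prop :=
  ∃ u w, u ∈ e₁ ∧ w ∈ e₂ ∧ (u = w ∨ G.Adj u w)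

/-- `c` is a strong edge-coloring of `G` (viewed as a function on all of `Sym2 V`,
only its values on edges of `G` matter). -/
def IsStrongEdgeColoringOn {V : Type*} (G : SimpleGraph V) (c : Sym2 V → ℕ) : Prop :=
  ∀ e₁ ∈ G.edgeSet, ∀ e₂ ∈ G.edgeSet, e₁ ≠ e₂ → EdgeClose G e₁ e₂ → c e₁ ≠ c e₂

/-- `G` is strongly `L`-edge-colorable. -/
def StronglyLColorable {V : Type*} (G : SimpleGraph V) (L : Sym2 V → Finset ℕ) : Prop :=
  ∃ c : Sym2 V → ℕ, IsStrongEdgeColoringOn G c ∧ ∀ e ∈ G.edgeSet, c e ∈ L e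

/-- `G` is strongly `k`-edge-choosable. -/
def StronglyEdgeChoosable {V : Type*} (G : SimpleGraph V) (k : ℕ) : Prop :=
  ∀ L : Sym2 V → Finset ℕ, (∀ e ∈ G.edgeSet, k ≤ (L e).card) → StronglyLColorable G L

set_option linter.unusedSectionVars false

namespace SEC

theorem close_symm {V : Type*} {G : SimpleGraph V} {e f : Sym2 V} (h : EdgeClose G e f) :
    EdgeClose G f e := by
  obtain ⟨u, w, hu, hw, h⟩ := h
  exact ⟨w, u, hw, hu, h.elim (fun h => Or.inl h.symm) (fun h => Or.inr h.symm)⟩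

section
variable {V : Type*} [Fintype V] [DecidableEq V] (G : SimpleGraph V) [DecidableRel G.Adj]
  (L : Sym2 V → Finset ℕ)

open Classical in
noncomputable def T (z : Sym2 V) : Finset (Sym2 V) :=
  G.edgeFinset.filter (fun f => f ≠ z ∧ EdgeClose G z f)

theorem mem_T {z f : Sym2 V} : f ∈ T G z ↔ f ∈ G.edgeSet ∧ f ≠ z ∧ EdgeClose G z f := by
  simp [T]

def Valid (S : Finset (Sym2 V)) (c : Sym2 V → ℕ) : Prop :=
  (∀ e ∈ S, e ∈ G.edgeSet) ∧ (∀ e ∈ S, c e ∈ L e) ∧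
    ∀ e ∈ S, ∀ f ∈ S, e ≠ f → EdgeClose G e f → c e ≠ c f

noncomputable def col (c : Sym2 V → ℕ) (S : Finset (Sym2 V)) (z : Sym2 V) : ℕ :=
  ((S ∩ T G z).image c ∩ L z).card

def Gain (c : Sym2 V → ℕ) (z x y : Sym2 V) : Prop :=
  c x = c y ∨ c x ∉ L z ∨ c y ∉ L z

variable {G L}

theorem ext_color {S : Finset (Sym2 V)} {c : Sym2 V → ℕ} (h : Valid G L S c) {z : Sym2 V}
    (hz : z ∈ G.edgeSet) (hzS : z ∉ S) {a : ℕ} (ha : a ∈ L z)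
    (hn : ∀ f ∈ S, EdgeClose G z f → c f ≠ a) :
    Valid G L (insert z S) (Function.update c z a) := by
  obtain ⟨h1, h2, h3⟩ := h
  have hne : ∀ e ∈ S, e ≠ z := fun e he h => hzS (h ▸ he)
  refine ⟨?_, ?_, ?_⟩
  · intro e he
    rcases Finset.mem_insert.1 he with rfl | he
    · exact hz
    · exact h1 e he
  · intro e he
    rcases Finset.mem_insert.1 he with rfl | he
    · simpa using ha
    · rw [Function.update_of_ne (hne e he)]; exact h2 e he
  · intro e he f hf hef hc
    rcases Finset.mem_insert.1 he with h4 | h4 <;> rcases Finset.mem_insert.1 hf with h5 | h5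
    · exact absurd (h4.trans h5.symm) hef
    · subst h4
      rw [Function.update_self, Function.update_of_ne (hne f h5)]; exact (hn f h5 hc).symm
    · subst h5
      rw [Function.update_self, Function.update_of_ne (hne e h4)]; exact hn e h4 (close_symm hc)
    · rw [Function.update_of_ne (hne f h5), Function.update_of_ne (hne e h4)]
      exact h3 e h4 f h5 hef hc

theorem ext1 {S : Finset (Sym2 V)} {c : Sym2 V → ℕ} (h : Valid G L S c) {z : Sym2 V}
    (hz : z ∈ G.edgeSet) (hL : (L z).card = 22) (hc : col G L c S z < 22) :
    ∃ c', Valid G L (insert z S) c' ∧ ∀ e ∈ S, c' e = c e := by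
  by_cases hzS : z ∈ S
  · exact ⟨c, by rwa [Finset.insert_eq_of_mem hzS], fun _ _ => rfl⟩
  have : ∃ a ∈ L z, a ∉ (S ∩ T G z).image c ∩ L z := by
    apply Finset.exists_mem_notMem_of_card_lt_card
    unfold col at hc; omega
  obtain ⟨a, ha, hna⟩ := this
  refine ⟨Function.update c z a, ext_color h hz hzS ha ?_, ?_⟩
  · intro f hf hzf hfa
    apply hna
    rw [Finset.mem_inter, Finset.mem_image]
    refine ⟨⟨f, ?_, hfa⟩, ha⟩
    rw [Finset.mem_inter, mem_T]
    exact ⟨hf, h.1 f hf, fun h => hzS (h ▸ hf), hzf⟩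
  · intro e he
    have hne : e ≠ z := fun h => hzS (h ▸ he)
    exact Function.update_of_ne hne _ _

theorem col_congr {c c' : Sym2 V → ℕ} {S : Finset (Sym2 V)} (h : ∀ e ∈ S, c' e = c e) (z : Sym2 V) :
    col G L c' S z = col G L c S z := by
  unfold col
  congr 2
  apply Finset.image_congr
  intro e he
  exact h e (Finset.mem_inter.1 he).1

theorem col_insert {c : Sym2 V → ℕ} {S : Finset (Sym2 V)} (x z : Sym2 V) :
    col G L c (insert x S) z ≤ col G L c S z + 1 := by
  unfold col
  refine (Finset.card_le_card (t := insert (c x) ((S ∩ T G z).image c ∩ L z)) ?_).trans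
    (Finset.card_insert_le _ _)
  intro a
  simp only [Finset.mem_inter, Finset.mem_image, Finset.mem_insert]
  rintro ⟨⟨e, ⟨rfl | he, h2⟩, rfl⟩, h3⟩
  · exact Or.inl rfl
  · exact Or.inr ⟨⟨e, ⟨he, h2⟩, rfl⟩, h3⟩

theorem finish (hL : ∀ e ∈ G.edgeSet, (L e).card = 22) :
    ∀ (zs : List (Sym2 V)) (S : Finset (Sym2 V)) (c : Sym2 V → ℕ), Valid G L S c →
      (∀ z ∈ zs, z ∈ G.edgeSet) →
      (∀ i (h : i < zs.length), col G L c S zs[i] + i < 22) →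
      ∃ c', Valid G L (S ∪ zs.toFinset) c' := by
  intro zs
  induction zs with
  | nil => intro S c h _ _; exact ⟨c, by simpa using h⟩
  | cons z zs ih =>
    intro S c h hz hi
    have h0 := hi 0 (by simp)
    obtain ⟨c1, hv, he⟩ := ext1 h (hz z (by simp)) (hL _ (hz z (by simp))) (by simpa using h0)
    obtain ⟨c2, h2⟩ := ih (insert z S) c1 hv (fun w hw => hz w (by simp [hw])) (by
      intro i hil
      have := hi (i+1) (by simpa using hil)
      simp only [List.getElem_cons_succ] at this
      have h3 := col_insert (G := G) (L := L) (c := c1) (S := S) z zs[i]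
      rw [col_congr he] at h3
      omega)
    refine ⟨c2, ?_⟩
    convert h2 using 1
    ext e; simp

theorem col_le_card (c : Sym2 V → ℕ) (S : Finset (Sym2 V)) (z : Sym2 V) :
    col G L c S z ≤ (S ∩ T G z).card :=
  (Finset.card_le_card Finset.inter_subset_left).trans Finset.card_image_le

theorem greedy (hL : ∀ e ∈ G.edgeSet, (L e).card = 22) (rank : Sym2 V → ℕ)
    (S0 : Finset (Sym2 V)) (c : Sym2 V → ℕ) (h0 : Valid G L S0 c) :
    ∀ (n : ℕ) (M : Finset (Sym2 V)), M.card = n → (∀ e ∈ M, e ∈ G.edgeSet) →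
      (∀ e ∈ M, ((S0 ∪ M.filter (fun f => rank e ≤ rank f)) ∩ T G e).card ≤ 21) →
      ∃ c', Valid G L (S0 ∪ M) c' ∧ ∀ e ∈ S0, c' e = c e := by
  intro n
  induction n with
  | zero =>
    intro M hM _ _
    rw [Finset.card_eq_zero] at hM
    subst hM
    exact ⟨c, by simpa using h0, fun _ _ => rfl⟩
  | succ n ih =>
    intro M hM hE hb
    have hne : M.Nonempty := by rw [← Finset.card_pos]; omega
    obtain ⟨e, he, hmin⟩ := Finset.exists_min_image M rank hne
    obtain ⟨c1, hv, hc1⟩ := ih (M.erase e) (by rw [Finset.card_erase_of_mem he]; omega)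
      (fun f hf => hE f (Finset.mem_of_mem_erase hf)) (by
        intro f hf
        refine le_trans (Finset.card_le_card ?_) (hb f (Finset.mem_of_mem_erase hf))
        intro g
        simp only [Finset.mem_inter, Finset.mem_union, Finset.mem_filter, Finset.mem_erase]
        tauto)
    obtain ⟨c2, hv2, hc2⟩ := ext1 hv (hE e he) (hL e (hE e he)) (by
      refine lt_of_le_of_lt ((col_le_card _ _ _).trans ((Finset.card_le_card ?_).trans (hb e he)))
        (by norm_num)
      intro g
      simp only [Finset.mem_inter, Finset.mem_union, Finset.mem_filter, Finset.mem_erase]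
      rintro ⟨h | h, h'⟩
      · exact ⟨Or.inl h, h'⟩
      · exact ⟨Or.inr ⟨h.2, hmin g h.2⟩, h'⟩)
    refine ⟨c2, ?_, ?_⟩
    · convert hv2 using 1
      ext g; simp only [Finset.mem_insert, Finset.mem_union, Finset.mem_erase]
      by_cases hg : g = e
      · subst hg; simp [he]
      · simp [hg]
    · intro f hf
      rw [hc2 f (by simp [hf]), hc1 f hf]

theorem col_pair (c : Sym2 V → ℕ) (A : Finset ℕ) (K : Finset (Sym2 V)) {x y : Sym2 V}
    (hg : c x = c y ∨ c x ∉ A ∨ c y ∉ A) :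
    (K.image c ∩ A).card ≤ (((K.erase x).erase y).image c ∩ A).card + 1 := by
  have key : ∃ a, K.image c ∩ A ⊆ insert a (((K.erase x).erase y).image c ∩ A) := by
    rcases hg with h | h | h
    · refine ⟨c x, ?_⟩
      intro a
      simp only [Finset.mem_inter, Finset.mem_image, Finset.mem_insert, Finset.mem_erase]
      rintro ⟨⟨e, he, rfl⟩, h3⟩
      by_cases h1 : e = x
      · subst h1; exact Or.inl rfl
      by_cases h2 : e = y
      · subst h2; exact Or.inl h.symm
      exact Or.inr ⟨⟨e, ⟨h2, h1, he⟩, rfl⟩, h3⟩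
    · refine ⟨c y, ?_⟩
      intro a
      simp only [Finset.mem_inter, Finset.mem_image, Finset.mem_insert, Finset.mem_erase]
      rintro ⟨⟨e, he, rfl⟩, h3⟩
      by_cases h1 : e = x
      · subst h1; exact absurd h3 h
      by_cases h2 : e = y
      · subst h2; exact Or.inl rfl
      exact Or.inr ⟨⟨e, ⟨h2, h1, he⟩, rfl⟩, h3⟩
    · refine ⟨c x, ?_⟩
      intro a
      simp only [Finset.mem_inter, Finset.mem_image, Finset.mem_insert, Finset.mem_erase]
      rintro ⟨⟨e, he, rfl⟩, h3⟩
      by_cases h1 : e = x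
      · subst h1; exact Or.inl rfl
      by_cases h2 : e = y
      · subst h2; exact absurd h3 h
      exact Or.inr ⟨⟨e, ⟨h2, h1, he⟩, rfl⟩, h3⟩
  obtain ⟨a, ha⟩ := key
  exact (Finset.card_le_card ha).trans (Finset.card_insert_le _ _)

theorem col_pairs (c : Sym2 V → ℕ) (A : Finset ℕ) :
    ∀ (gs : List (Sym2 V × Sym2 V)) (K : Finset (Sym2 V)),
      (gs.flatMap (fun p => [p.1, p.2])).Nodup →
      (∀ p ∈ gs, p.1 ∈ K ∧ p.2 ∈ K ∧ (c p.1 = c p.2 ∨ c p.1 ∉ A ∨ c p.2 ∉ A)) →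
      (K.image c ∩ A).card + gs.length ≤ K.card := by
  intro gs
  induction gs with
  | nil =>
    intro K _ _
    simpa using (Finset.card_le_card Finset.inter_subset_left).trans Finset.card_image_le
  | cons p gs ih =>
    intro K hnd hK
    simp only [List.flatMap_cons, List.cons_append, List.nil_append, List.nodup_cons,
      List.mem_cons, not_or] at hnd
    obtain ⟨⟨hxy, hx⟩, hy, hnd⟩ := hnd
    obtain ⟨h1, h2, h3⟩ := hK p (by simp)
    have := ih ((K.erase p.1).erase p.2) hnd (by
      intro q hq
      obtain ⟨q1, q2, q3⟩ := hK q (by simp [hq])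
      have m1 : q.1 ∈ gs.flatMap (fun p => [p.1, p.2]) := List.mem_flatMap.2 ⟨q, hq, by simp⟩
      have m2 : q.2 ∈ gs.flatMap (fun p => [p.1, p.2]) := List.mem_flatMap.2 ⟨q, hq, by simp⟩
      refine ⟨?_, ?_, q3⟩
      · rw [Finset.mem_erase, Finset.mem_erase]
        exact ⟨fun h => hy (h ▸ m1), fun h => hx (h ▸ m1), q1⟩
      · rw [Finset.mem_erase, Finset.mem_erase]
        exact ⟨fun h => hy (h ▸ m2), fun h => hx (h ▸ m2), q2⟩)
    have h4 := col_pair c A K h3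
    rw [Finset.card_erase_of_mem (Finset.mem_erase.2 ⟨fun h => hxy h.symm, h2⟩),
      Finset.card_erase_of_mem h1] at this
    have : 1 < K.card := Finset.one_lt_card.2 ⟨_, h1, _, h2, hxy⟩
    simp only [List.length_cons]
    omega

theorem gain_colors (X Y : Finset ℕ) (zs : Finset (Sym2 V))
    (hz : ∀ z ∈ zs, (L z).card = 22) (hc : 121 * zs.card < X.card * Y.card) :
    ∃ x ∈ X, ∃ y ∈ Y, x = y ∨ ∀ z ∈ zs, x ∉ L z ∨ y ∉ L z := by
  by_contra! hcon
  have hd : Disjoint X Y := by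
    rw [Finset.disjoint_left]
    intro a ha hb
    exact (hcon a ha a hb).1 rfl
  have hsub : X ×ˢ Y ⊆ zs.biUnion (fun z => (X ∩ L z) ×ˢ (Y ∩ L z)) := by
    rintro ⟨x, y⟩ h
    rw [Finset.mem_product] at h
    obtain ⟨z, hz, h1, h2⟩ := (hcon x h.1 y h.2).2
    simp only [Finset.mem_biUnion, Finset.mem_product, Finset.mem_inter]
    exact ⟨z, hz, ⟨h.1, h1⟩, h.2, h2⟩
  have h1 := Finset.card_le_card hsub
  rw [Finset.card_product] at h1
  have h2 : (zs.biUnion (fun z => (X ∩ L z) ×ˢ (Y ∩ L z))).card ≤ zs.card * 121 := by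
    apply Finset.card_biUnion_le_card_mul
    intro z hzz
    rw [Finset.card_product]
    have h3 : (X ∩ L z).card + (Y ∩ L z).card ≤ 22 := by
      rw [← hz z hzz, ← Finset.card_union_of_disjoint]
      · apply Finset.card_le_card
        exact Finset.union_subset Finset.inter_subset_right Finset.inter_subset_right
      · exact Disjoint.mono Finset.inter_subset_left Finset.inter_subset_left hd
    generalize (X ∩ L z).card = p at *
    generalize (Y ∩ L z).card = q at *
    zify at *
    nlinarith [sq_nonneg ((p:ℤ) - q)]
  omega

theorem ext_pair (hL : ∀ e ∈ G.edgeSet, (L e).card = 22) {S : Finset (Sym2 V)} {c : Sym2 V → ℕ}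
    (h : Valid G L S c) {x y : Sym2 V} (hx : x ∈ G.edgeSet) (hy : y ∈ G.edgeSet)
    (hxS : x ∉ S) (hyS : y ∉ S) (hxy : x ≠ y) (hcl : ¬ EdgeClose G x y)
    (zs : Finset (Sym2 V)) (hzs : ∀ z ∈ zs, z ∈ G.edgeSet)
    (hcard : 121 * zs.card < (22 - S.card) * (22 - S.card)) :
    ∃ c', Valid G L (insert x (insert y S)) c' ∧ (∀ e ∈ S, c' e = c e) ∧
      ∀ z ∈ zs, Gain L c' z x y := by
  have hX : ∀ e ∈ G.edgeSet, 22 - S.card ≤ (L e \ S.image c).card := by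
    intro e he
    have := Finset.le_card_sdiff (S.image c) (L e)
    have h2 : (S.image c).card ≤ S.card := Finset.card_image_le
    rw [hL e he] at this
    omega
  obtain ⟨a, ha, b, hb, hab⟩ := gain_colors (L := L) (L x \ S.image c) (L y \ S.image c) zs
    (fun z hz => hL z (hzs z hz)) (lt_of_lt_of_le hcard (Nat.mul_le_mul (hX x hx) (hX y hy)))
  rw [Finset.mem_sdiff] at ha hb
  have v1 := ext_color h hy hyS hb.1 (fun f hf _ hfa => hb.2 (Finset.mem_image.2 ⟨f, hf, hfa⟩))
  have hSy : ∀ e ∈ S, e ≠ y := fun e he h => hyS (h ▸ he)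
  have hSx : ∀ e ∈ S, e ≠ x := fun e he h => hxS (h ▸ he)
  have v2 := ext_color (z := x) (a := a) v1 hx (by simp [hxy, hxS]) ha.1 (by
    intro f hf hcf
    rcases Finset.mem_insert.1 hf with rfl | hf
    · exact absurd hcf hcl
    · rw [Function.update_of_ne (hSy f hf)]
      exact fun hfa => ha.2 (Finset.mem_image.2 ⟨f, hf, hfa⟩))
  refine ⟨_, v2, ?_, ?_⟩
  · intro e he
    rw [Function.update_of_ne (hSx e he), Function.update_of_ne (hSy e he)]
  · intro z hz
    unfold Gain
    rw [Function.update_self, Function.update_of_ne hxy.symm, Function.update_self]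
    rcases hab with hab | hab
    · exact Or.inl hab
    · exact Or.inr (hab z hz)

variable (G) in
def W (u v : V) : Finset V := (G.neighborFinset u).erase v ∪ (G.neighborFinset v).erase u

variable (G) in
def nonr (r : V) : Finset (Sym2 V) := G.edgeFinset.filter (fun e => r ∉ e)

theorem mem_nonr {r : V} {e : Sym2 V} : e ∈ nonr G r ↔ e ∈ G.edgeSet ∧ r ∉ e := by
  simp [nonr]

theorem mem_W {u v x : V} : x ∈ W G u v ↔ (x ≠ v ∧ G.Adj u x) ∨ (x ≠ u ∧ G.Adj v x) := by
  simp [W]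

theorem T_inc {u v : V} {f : Sym2 V} (hf : f ∈ T G s(u, v)) :
    ∃ w ∈ W G u v, w ∈ f := by
  rw [mem_T] at hf
  obtain ⟨hE, hne, a, b, ha, hb, hab⟩ := hf
  induction f with
  | _ p q =>
  rw [SimpleGraph.mem_edgeSet] at hE
  simp only [mem_W, Sym2.mem_iff] at *
  have hqp := hE.symm
  by_cases h1 : p = u <;> by_cases h2 : p = v <;> by_cases h3 : q = u <;> by_cases h4 : q = v <;>
    simp_all <;> grind [SimpleGraph.Adj.ne, SimpleGraph.adj_comm]

theorem W_card {u v : V} (h : G.Adj u v) : (W G u v).card ≤ (G.degree u - 1) + (G.degree v - 1) := by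
  refine (Finset.card_union_le _ _).trans ?_
  rw [Finset.card_erase_of_mem (by simpa using h), Finset.card_erase_of_mem (by simpa using h.symm)]
  simp

theorem W_card_tri {u v t : V} (h : G.Adj u v) (h1 : G.Adj u t) (h2 : G.Adj v t) :
    (W G u v).card + 1 ≤ (G.degree u - 1) + (G.degree v - 1) := by
  have := Finset.card_union_add_card_inter ((G.neighborFinset u).erase v) ((G.neighborFinset v).erase u)
  rw [Finset.card_erase_of_mem (by simpa using h), Finset.card_erase_of_mem (by simpa using h.symm)] at this
  have h3 : 0 < (((G.neighborFinset u).erase v) ∩ ((G.neighborFinset v).erase u)).card := by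
    rw [Finset.card_pos]
    exact ⟨t, by simp [h1, h2, h1.ne', h2.ne']⟩
  simp only [SimpleGraph.card_neighborFinset_eq_degree] at this
  unfold W
  omega

theorem inc_bound (hΔ : ∀ u, G.degree u ≤ 4) (X : Finset V) (A D : Finset (Sym2 V))
    (hA : ∀ f ∈ A, f ∈ G.edgeSet ∧ ∃ w ∈ X, w ∈ f)
    (hD : ∀ f ∈ D, f ∈ G.edgeSet ∧ ∃ a ∈ X, ∃ b ∈ X, a ≠ b ∧ a ∈ f ∧ b ∈ f) :
    A.card + D.card ≤ 4 * X.card := by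
  have h1 : ∑ f ∈ A ∪ D, (X.filter (fun w => w ∈ f)).card =
      ∑ w ∈ X, ((A ∪ D).filter (fun f => w ∈ f)).card :=
    (Finset.sum_card_bipartiteAbove_eq_sum_card_bipartiteBelow (s := X) (t := A ∪ D)
      (fun w f => w ∈ f)).symm
  have h2 : ∀ w ∈ X, ((A ∪ D).filter (fun f => w ∈ f)).card ≤ 4 := by
    intro w _
    refine le_trans ?_ (hΔ w)
    rw [← SimpleGraph.card_incidenceFinset_eq_degree]
    apply Finset.card_le_card
    intro f hf
    rw [Finset.mem_filter, Finset.mem_union] at hf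
    rw [SimpleGraph.mem_incidenceFinset]
    refine ⟨?_, hf.2⟩
    rcases hf.1 with h | h
    · exact (hA f h).1
    · exact (hD f h).1
  have h3 : ∑ w ∈ X, ((A ∪ D).filter (fun f => w ∈ f)).card ≤ X.card * 4 :=
    Finset.sum_le_card_nsmul _ _ _ h2
  have h4 : ∑ f ∈ A ∪ D, (1 + if f ∈ D then 1 else 0) ≤
      ∑ f ∈ A ∪ D, (X.filter (fun w => w ∈ f)).card := by
    apply Finset.sum_le_sum
    intro f hf
    split_ifs with hfD
    · obtain ⟨_, a, ha, b, hb, hab, haf, hbf⟩ := hD f hfD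
      exact Finset.one_lt_card.2 ⟨a, by simp [ha, haf], b, by simp [hb, hbf], hab⟩
    · rw [Finset.mem_union] at hf
      obtain ⟨_, w, hw, hwf⟩ := hA f (hf.resolve_right hfD)
      exact Finset.card_pos.2 ⟨w, by simp [hw, hwf]⟩
  rw [Finset.sum_add_distrib, Finset.sum_ite_mem] at h4
  simp at h4
  have h5 : A.card ≤ (A ∪ D).card := Finset.card_le_card Finset.subset_union_left
  omega

theorem T_bound (hΔ : ∀ u, G.degree u ≤ 4) (u v : V) (D : Finset (Sym2 V))
    (hD : ∀ f ∈ D, f ∈ G.edgeSet ∧ ∃ a ∈ W G u v, ∃ b ∈ W G u v, a ≠ b ∧ a ∈ f ∧ b ∈ f) :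
    (T G s(u, v)).card + D.card ≤ 4 * (W G u v).card :=
  inc_bound hΔ _ _ _ (fun f hf => ⟨((mem_T G).1 hf).1, T_inc hf⟩) hD

def rk (d : V → ℕ) : Sym2 V → ℕ :=
  Sym2.lift ⟨fun a b => min (d a) (d b), fun a b => min_comm _ _⟩

theorem rk_le (d : V → ℕ) {e : Sym2 V} {w : V} (h : w ∈ e) : rk d e ≤ d w := by
  induction e with
  | _ p q =>
  simp only [Sym2.mem_iff] at h
  simp only [rk, Sym2.lift_mk]
  rcases h with rfl | rfl <;> simp

theorem main (hconn : G.Connected) (hΔ : ∀ u, G.degree u ≤ 4)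
    (hL : ∀ e ∈ G.edgeSet, (L e).card = 22) (r : V) (P : Finset (Sym2 V)) (c0 : Sym2 V → ℕ)
    (hP : Valid G L P c0) (hm : ∀ v, ∀ e ∈ P, ∀ f ∈ P, v ∈ e → v ∈ f → e = f) :
    ∃ c, Valid G L (P ∪ nonr G r) c ∧ ∀ e ∈ P, c e = c0 e := by
  refine greedy hL (rk (fun v => G.dist r v)) P c0 hP _ (nonr G r) rfl
    (fun e he => (mem_nonr.1 he).1) ?_
  intro e he
  obtain ⟨heE, her⟩ := mem_nonr.1 he
  obtain ⟨u, v, rfl, huv⟩ : ∃ u v, e = s(u, v) ∧ G.dist r u ≤ G.dist r v := by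
    induction e with
    | _ p q =>
    rcases le_total (G.dist r p) (G.dist r q) with h | h
    · exact ⟨p, q, rfl, h⟩
    · exact ⟨q, p, Sym2.eq_swap, h⟩
  have hadj : G.Adj u v := heE
  have hru : r ≠ u := fun h => her (by simp [h])
  obtain ⟨u', hu', hd⟩ : ∃ u', G.Adj u u' ∧ G.dist r u' < G.dist r u := by
    obtain ⟨p, hp⟩ := hconn.exists_walk_length_eq_dist u r
    cases p with
    | nil => exact absurd rfl hru
    | @cons _ w _ h q =>
      refine ⟨w, h, ?_⟩
      have := SimpleGraph.dist_le q
      rw [SimpleGraph.Walk.length_cons] at hp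
      rw [SimpleGraph.dist_comm, SimpleGraph.dist_comm (u := r) (v := u)]
      omega
  have hrk : rk (fun v => G.dist r v) s(u, v) = G.dist r u := by
    simp [rk, huv]
  have hu'W : u' ∈ W G u v := by
    rw [mem_W]
    refine Or.inl ⟨?_, hu'⟩
    rintro rfl
    omega
  have hWc : ((W G u v).erase u').card ≤ 5 := by
    have := W_card hadj
    have := hΔ u
    have := hΔ v
    rw [Finset.card_erase_of_mem hu'W]
    omega
  let Q := P.filter (fun f => u' ∈ f)
  have hQ : Q.card ≤ 1 := by
    rw [Finset.card_le_one]
    intro a ha b hb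
    simp only [Q, Finset.mem_filter] at ha hb
    exact hm u' a ha.1 b hb.1 ha.2 hb.2
  let A := ((P ∪ (nonr G r).filter (fun f => rk (fun v => G.dist r v) s(u, v) ≤
    rk (fun v => G.dist r v) f)) ∩ T G s(u, v))
  have hA : (A \ Q).card + (∅ : Finset (Sym2 V)).card ≤ 4 * ((W G u v).erase u').card := by
    apply inc_bound hΔ
    · intro f hf
      rw [Finset.mem_sdiff, Finset.mem_inter] at hf
      obtain ⟨⟨hf1, hfT⟩, hfQ⟩ := hf
      refine ⟨((mem_T G).1 hfT).1, ?_⟩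
      obtain ⟨w, hw, hwf⟩ := T_inc hfT
      refine ⟨w, Finset.mem_erase.2 ⟨?_, hw⟩, hwf⟩
      rintro rfl
      rw [Finset.mem_union, Finset.mem_filter] at hf1
      rcases hf1 with h | h
      · exact hfQ (Finset.mem_filter.2 ⟨h, hwf⟩)
      · have h2 := h.2
        have h3 := rk_le (fun v => G.dist r v) hwf
        rw [hrk] at h2
        omega
    · simp
  have h6 : A.card ≤ (A \ Q).card + Q.card := by
    have := Finset.le_card_sdiff Q A
    omega
  change A.card ≤ 21
  simp at hA
  omega

theorem done {S : Finset (Sym2 V)} {c : Sym2 V → ℕ} (h : Valid G L S c)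
    (hS : ∀ e ∈ G.edgeSet, e ∈ S) : StronglyLColorable G L :=
  ⟨c, fun e he f hf => h.2.2 e (hS e he) f (hS f hf), fun e he => h.2.1 e (hS e he)⟩

theorem root_T {r n m : V} (hn : G.Adj r n) (hm : G.Adj r m) (hnm : m ≠ n) :
    s(r, m) ∈ T G s(r, n) := by
  rw [mem_T]
  refine ⟨hm, ?_, r, r, by simp, by simp, Or.inl rfl⟩
  simp only [ne_eq, Sym2.eq_iff]
  have := hn.ne
  have := hm.ne
  grind

theorem K_card {S Q : Finset (Sym2 V)} {z : Sym2 V} (hQ : Q ⊆ T G z) (hd : Disjoint Q S) :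
    (S ∩ T G z).card + Q.card ≤ (T G z).card := by
  rw [← Finset.card_union_of_disjoint]
  · apply Finset.card_le_card
    exact Finset.union_subset Finset.inter_subset_right hQ
  · exact (hd.symm).mono_left Finset.inter_subset_left

/-- degree at most three -/
theorem case_low (hconn : G.Connected) (hΔ : ∀ u, G.degree u ≤ 4)
    (hL : ∀ e ∈ G.edgeSet, (L e).card = 22) (r : V) (hr : G.degree r ≤ 3) :
    StronglyLColorable G L := by
  obtain ⟨c, hc, -⟩ := main hconn hΔ hL r ∅ (fun _ => 0) (by simp [Valid]) (by simp)
  obtain ⟨c', hc', -⟩ := greedy hL (fun _ => 0) _ c hc _ (G.edgeFinset.filter (fun e => r ∈ e)) rfl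
    (by intro e he; simpa using (Finset.mem_filter.1 he).1) (by
      intro e he
      rw [Finset.mem_filter] at he
      refine (Finset.card_le_card Finset.inter_subset_right).trans ?_
      obtain ⟨n, rfl⟩ := Sym2.mem_iff_exists.1 he.2
      have hadj : G.Adj r n := by simpa using he.1
      have h1 := T_bound hΔ r n ∅ (by simp)
      have h2 := W_card hadj
      have := hΔ n
      simp at h1
      omega)
  refine done hc' ?_
  intro e he
  simp only [Finset.mem_union, Finset.mem_filter, mem_nonr, SimpleGraph.mem_edgeFinset]
  tauto

theorem T_bound4 (hΔ : ∀ u, G.degree u ≤ 4) {u v : V} (h : G.Adj u v) (D : Finset (Sym2 V))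
    (hD : ∀ f ∈ D, f ∈ G.edgeSet ∧ ∃ a ∈ W G u v, ∃ b ∈ W G u v, a ≠ b ∧ a ∈ f ∧ b ∈ f) :
    (T G s(u, v)).card + D.card ≤ 24 := by
  have h1 := T_bound hΔ u v D hD
  have h2 := W_card h
  have := hΔ u
  have := hΔ v
  omega

theorem T_tri (hΔ : ∀ u, G.degree u ≤ 4) {u v t : V} (h : G.Adj u v) (h1 : G.Adj u t)
    (h2 : G.Adj v t) : (T G s(u, v)).card ≤ 20 := by
  have h1 := T_bound hΔ u v ∅ (by simp)
  have h2 := W_card_tri h ‹_› h2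
  have := hΔ u
  have := hΔ v
  simp at h1
  omega

/-- finishing with a root of degree four whose edges are not precolored -/
theorem finish4 (hL : ∀ e ∈ G.edgeSet, (L e).card = 22) {r n1 n2 n3 n4 : V} {c : Sym2 V → ℕ}
    (hc : Valid G L (nonr G r) c) (hN : ∀ x, G.Adj r x ↔ x = n1 ∨ x = n2 ∨ x = n3 ∨ x = n4)
    (h1 : col G L c (nonr G r) s(r, n1) < 22) (h2 : col G L c (nonr G r) s(r, n2) + 1 < 22)
    (h3 : col G L c (nonr G r) s(r, n3) + 2 < 22) (h4 : col G L c (nonr G r) s(r, n4) + 3 < 22) :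
    StronglyLColorable G L := by
  obtain ⟨c', hc'⟩ := finish hL [s(r, n1), s(r, n2), s(r, n3), s(r, n4)] _ c hc (by
    simp [hN]) (by
    intro i hi
    simp only [List.length_cons, List.length_nil] at hi
    interval_cases i <;> simpa)
  refine done hc' ?_
  intro e he
  by_cases hr : r ∈ e
  · obtain ⟨n, rfl⟩ := Sym2.mem_iff_exists.1 hr
    have hadj : G.Adj r n := he
    rw [hN] at hadj
    rcases hadj with rfl | rfl | rfl | rfl <;> simp
  · exact Finset.mem_union_left _ (mem_nonr.2 ⟨he, hr⟩)

theorem K_root {r n a b d : V} (hn : G.Adj r n) (ha : G.Adj r a) (hb : G.Adj r b)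
    (hd : G.Adj r d) (h : [n, a, b, d].Nodup) :
    (nonr G r ∩ T G s(r, n)).card + 3 ≤ (T G s(r, n)).card := by
  have hq : ({s(r, a), s(r, b), s(r, d)} : Finset (Sym2 V)).card = 3 := by
    rw [Finset.card_eq_three]
    simp at h
    refine ⟨_, _, _, ?_, ?_, ?_, rfl⟩ <;> simp <;> grind
  rw [← hq]
  apply K_card
  · simp at h
    intro f hf
    simp only [Finset.mem_insert, Finset.mem_singleton] at hf
    rcases hf with rfl | rfl | rfl
    · exact root_T hn ha (by grind)
    · exact root_T hn hb (by grind)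
    · exact root_T hn hd (by grind)
  · rw [Finset.disjoint_left]
    intro f hf
    simp only [Finset.mem_insert, Finset.mem_singleton] at hf
    rcases hf with rfl | rfl | rfl <;> simp [mem_nonr]

theorem close_iff {a b c d : V} : EdgeClose G s(a, b) s(c, d) ↔
    (a = c ∨ G.Adj a c) ∨ (a = d ∨ G.Adj a d) ∨ (b = c ∨ G.Adj b c) ∨ (b = d ∨ G.Adj b d) := by
  unfold EdgeClose
  simp only [Sym2.mem_iff]
  constructor
  · rintro ⟨u, w, rfl | rfl, rfl | rfl, h⟩ <;> tauto
  · rintro (h | h | h | h)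
    · exact ⟨a, c, by simp, by simp, h⟩
    · exact ⟨a, d, by simp, by simp, h⟩
    · exact ⟨b, c, by simp, by simp, h⟩
    · exact ⟨b, d, by simp, by simp, h⟩

theorem nbrs0 {r : V} (hr : G.degree r = 4) :
    ∃ a b c d, [a, b, c, d].Nodup ∧ ∀ x, G.Adj r x ↔ x = a ∨ x = b ∨ x = c ∨ x = d := by
  rw [← SimpleGraph.card_neighborFinset_eq_degree, Finset.card_eq_succ] at hr
  obtain ⟨a, t, hat, ht, hc⟩ := hr
  obtain ⟨b, c, d, h1, h2, h3, rfl⟩ := Finset.card_eq_three.1 hc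
  refine ⟨a, b, c, d, ?_, ?_⟩
  · simp at hat ⊢; tauto
  · intro x
    rw [← SimpleGraph.mem_neighborFinset, ← ht]; simp

theorem nbrs1 {r a : V} (hr : G.degree r = 4) (ha : G.Adj r a) :
    ∃ b c d, [a, b, c, d].Nodup ∧ ∀ x, G.Adj r x ↔ x = a ∨ x = b ∨ x = c ∨ x = d := by
  obtain ⟨p, q, s, t, hn, h⟩ := nbrs0 hr
  simp only [List.nodup_cons, List.mem_cons, List.not_mem_nil, not_or] at *
  rcases (h a).1 ha with rfl | rfl | rfl | rfl
  · exact ⟨q, s, t, by grind, by grind⟩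
  · exact ⟨p, s, t, by grind, by grind⟩
  · exact ⟨p, q, t, by grind, by grind⟩
  · exact ⟨p, q, s, by grind, by grind⟩

theorem nbrs2 {r a b : V} (hr : G.degree r = 4) (ha : G.Adj r a) (hb : G.Adj r b) (hab : a ≠ b) :
    ∃ c d, [a, b, c, d].Nodup ∧ ∀ x, G.Adj r x ↔ x = a ∨ x = b ∨ x = c ∨ x = d := by
  obtain ⟨q, s, t, hn, h⟩ := nbrs1 hr ha
  simp only [List.nodup_cons, List.mem_cons, List.not_mem_nil, not_or] at *
  rcases (h b).1 hb with rfl | rfl | rfl | rfl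
  · exact absurd rfl hab
  · exact ⟨s, t, by grind, by grind⟩
  · exact ⟨q, t, by grind, by grind⟩
  · exact ⟨q, s, by grind, by grind⟩

theorem nbrs3 {r a b c : V} (hr : G.degree r = 4) (ha : G.Adj r a) (hb : G.Adj r b)
    (hc : G.Adj r c) (hab : a ≠ b) (hac : a ≠ c) (hbc : b ≠ c) :
    ∃ d, [a, b, c, d].Nodup ∧ ∀ x, G.Adj r x ↔ x = a ∨ x = b ∨ x = c ∨ x = d := by
  obtain ⟨s, t, hn, h⟩ := nbrs2 hr ha hb hab
  simp only [List.nodup_cons, List.mem_cons, List.not_mem_nil, not_or] at *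
  rcases (h c).1 hc with rfl | rfl | rfl | rfl
  · exact absurd rfl hac
  · exact absurd rfl hbc
  · exact ⟨t, by grind, by grind⟩
  · exact ⟨s, by grind, by grind⟩

theorem pick {x : V} (hx : G.degree x = 4) (p q s : V → Prop)
    (hp : ∀ a b, G.Adj x a → G.Adj x b → p a → p b → a = b)
    (hq : ∀ a b, G.Adj x a → G.Adj x b → q a → q b → a = b)
    (hs : ∀ a b, G.Adj x a → G.Adj x b → s a → s b → a = b) :
    ∃ y, G.Adj x y ∧ ¬ p y ∧ ¬ q y ∧ ¬ s y := by
  by_contra! hcon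
  obtain ⟨a, b, c, d, hn, h⟩ := nbrs0 hx
  simp only [List.nodup_cons, List.mem_cons, List.not_mem_nil, not_or] at *
  have ha := hcon a ((h a).2 (by simp))
  have hb := hcon b ((h b).2 (by simp))
  have hc := hcon c ((h c).2 (by simp))
  have hd := hcon d ((h d).2 (by simp))
  have ha' := ((h a).2 (by simp))
  have hb' := ((h b).2 (by simp))
  have hc' := ((h c).2 (by simp))
  have hd' := ((h d).2 (by simp))
  have hpp : ∀ a b, G.Adj x a → G.Adj x b → a ≠ b → ¬ (p a ∧ p b) := fun a b h1 h2 h3 h4 => h3 (hp a b h1 h2 h4.1 h4.2)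
  have hqq : ∀ a b, G.Adj x a → G.Adj x b → a ≠ b → ¬ (q a ∧ q b) := fun a b h1 h2 h3 h4 => h3 (hq a b h1 h2 h4.1 h4.2)
  have hss : ∀ a b, G.Adj x a → G.Adj x b → a ≠ b → ¬ (s a ∧ s b) := fun a b h1 h2 h3 h4 => h3 (hs a b h1 h2 h4.1 h4.2)
  obtain ⟨⟨n1, n2, n3, -⟩, ⟨n4, n5, -⟩, ⟨n6, -⟩, -⟩ := hn
  have := hpp a b ha' hb' n1
  have := hpp a c ha' hc' n2
  have := hpp a d ha' hd' n3
  have := hpp b c hb' hc' n4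
  have := hpp b d hb' hd' n5
  have := hpp c d hc' hd' n6
  have := hqq a b ha' hb' n1
  have := hqq a c ha' hc' n2
  have := hqq a d ha' hd' n3
  have := hqq b c hb' hc' n4
  have := hqq b d hb' hd' n5
  have := hqq c d hc' hd' n6
  have := hss a b ha' hb' n1
  have := hss a c ha' hc' n2
  have := hss a d ha' hd' n3
  have := hss b c hb' hc' n4
  have := hss b d hb' hd' n5
  have := hss c d hc' hd' n6
  clear hpp hqq hss hp hq hs h hcon
  by_cases pa : p a <;> by_cases pb : p b <;> by_cases pc : p c <;> by_cases pd : p d <;>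
    simp_all <;>
    by_cases qa : q a <;> by_cases qb : q b <;> by_cases qc : q c <;> by_cases qd : q d <;> simp_all

theorem col_root (hΔ : ∀ u, G.degree u ≤ 4) (c : Sym2 V → ℕ) {r n a b d : V} (hn : G.Adj r n)
    (ha : G.Adj r a) (hb : G.Adj r b) (hd : G.Adj r d) (h : [n, a, b, d].Nodup)
    (D : Finset (Sym2 V))
    (hD : ∀ f ∈ D, f ∈ G.edgeSet ∧ ∃ a ∈ W G r n, ∃ b ∈ W G r n, a ≠ b ∧ a ∈ f ∧ b ∈ f)
    (gs : List (Sym2 V × Sym2 V)) (hgs : (gs.flatMap (fun p => [p.1, p.2])).Nodup)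
    (hg : ∀ p ∈ gs, p.1 ∈ nonr G r ∩ T G s(r, n) ∧ p.2 ∈ nonr G r ∩ T G s(r, n) ∧
      Gain L c s(r, n) p.1 p.2) :
    col G L c (nonr G r) s(r, n) + gs.length + D.card + 3 ≤ 24 := by
  have h1 := K_root hn ha hb hd h
  have h2 := T_bound4 hΔ hn D hD
  have h3 : col G L c (nonr G r) s(r, n) + gs.length ≤ _ := col_pairs c (L s(r, n)) gs _ hgs hg
  omega

theorem case_tri (hconn : G.Connected) (hΔ : ∀ u, G.degree u ≤ 4)
    (hL : ∀ e ∈ G.edgeSet, (L e).card = 22) (h4 : ∀ u, G.degree u = 4) {r n1 n2 : V}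
    (h1 : G.Adj r n1) (h2 : G.Adj r n2) (h12 : G.Adj n1 n2) :
    StronglyLColorable G L := by
  obtain ⟨n3, n4, hn, hN⟩ := nbrs2 (h4 r) h1 h2 h12.ne
  obtain ⟨c, hc, -⟩ := main hconn hΔ hL r ∅ (fun _ => 0) (by simp [Valid]) (by simp)
  rw [Finset.empty_union] at hc
  have a3 : G.Adj r n3 := by simp [hN]
  have a4 : G.Adj r n4 := by simp [hN]
  have hn' := hn
  simp only [List.nodup_cons, List.mem_cons, List.not_mem_nil, not_or] at hn'
  refine finish4 (n1 := n3) (n2 := n4) (n3 := n1) (n4 := n2) hL hc (by intro x; rw [hN]; tauto) ?_ ?_ ?_ ?_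
  · have := col_root (L := L) hΔ c a3 a4 h1 h2 (by simp; grind) {s(n1, n2)} (by
      simp only [Finset.mem_singleton, forall_eq]
      refine ⟨h12, n1, mem_W.2 (Or.inl ⟨by grind, h1⟩), n2, mem_W.2 (Or.inl ⟨by grind, h2⟩), h12.ne, by simp, by simp⟩)
      [] (by simp) (by simp)
    simp at this; omega
  · have := col_root (L := L) hΔ c a4 a3 h1 h2 (by simp; grind) {s(n1, n2)} (by
      simp only [Finset.mem_singleton, forall_eq]
      refine ⟨h12, n1, mem_W.2 (Or.inl ⟨by grind, h1⟩), n2, mem_W.2 (Or.inl ⟨by grind, h2⟩), h12.ne, by simp, by simp⟩)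
      [] (by simp) (by simp)
    simp at this; omega
  · have := T_tri hΔ h1 h2 h12
    have := K_root h1 h2 a3 a4 hn
    have := col_le_card (G := G) (L := L) c (nonr G r) s(r, n1)
    omega
  · have := T_tri hΔ h2 h1 h12.symm
    have := K_root h2 h1 a3 a4 (by simp; grind)
    have := col_le_card (G := G) (L := L) c (nonr G r) s(r, n2)
    omega

theorem empty_valid : Valid G L ∅ (fun _ => 0) := by simp [Valid]

/-- edges at neighbours of the endpoints -/
theorem mem_KT {r n x y : V} (hxy : G.Adj x y) (hx : x ≠ r) (hy : y ≠ r)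
    (h : x = n ∨ G.Adj r x ∨ G.Adj n x) : s(x, y) ∈ nonr G r ∩ T G s(r, n) := by
  rw [Finset.mem_inter, mem_nonr, mem_T, close_iff]
  refine ⟨⟨hxy, by simp [hx.symm, hy.symm]⟩, hxy, ?_, ?_⟩
  · simp [hx, hy]
  · rcases h with rfl | h | h <;> simp [*]

theorem Gain_congr {c c' : Sym2 V → ℕ} {z x y : Sym2 V} (h : Gain L c z x y) (hx : c' x = c x)
    (hy : c' y = c y) : Gain L c' z x y := by
  unfold Gain at *; rw [hx, hy]; exact h

/-- one pair -/
theorem case_K23_aux (hconn : G.Connected) (hΔ : ∀ u, G.degree u ≤ 4)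
    (hL : ∀ e ∈ G.edgeSet, (L e).card = 22) (h4 : ∀ u, G.degree u = 4)
    (tri : ∀ a b c, G.Adj a b → G.Adj b c → ¬ G.Adj a c) {u v a b c : V} (huv : u ≠ v)
    (hua : G.Adj u a) (hub : G.Adj u b) (huc : G.Adj u c)
    (hva : G.Adj v a) (hvb : G.Adj v b) (hvc : G.Adj v c) (hab : a ≠ b) (hac : a ≠ c)
    (hbc : b ≠ c) (hx : (∀ t, t ≠ u → t ≠ v → G.Adj b t → ¬ G.Adj c t) ∨
      ∃ t, t ≠ u ∧ t ≠ v ∧ G.Adj a t ∧ G.Adj b t) :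
    StronglyLColorable G L := by
  obtain ⟨d, hn, hN⟩ := nbrs3 (h4 u) hua hub huc hab hac hbc
  have hud : G.Adj u d := by simp [hN]
  have hn' := hn
  simp only [List.nodup_cons, List.mem_cons, List.not_mem_nil, not_or] at hn'
  -- it suffices to save one more at ua
  suffices H : ∃ P c0, Valid G L P c0 ∧ (∀ v, ∀ e ∈ P, ∀ f ∈ P, v ∈ e → v ∈ f → e = f) ∧
      P ⊆ nonr G u ∧ ∀ c, Valid G L (nonr G u) c → (∀ e ∈ P, c e = c0 e) →
        col G L c (nonr G u) s(u, a) ≤ 18 by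
    obtain ⟨P, c0, hP, hm, hPn, hcol⟩ := H
    obtain ⟨cc, hcc, hagree⟩ := main hconn hΔ hL u P c0 hP hm
    rw [Finset.union_eq_right.2 hPn] at hcc
    have hcol := hcol cc hcc hagree
    refine finish4 (n1 := d) (n2 := c) (n3 := b) (n4 := a) hL hcc (by intro x; rw [hN]; tauto) ?_ ?_ ?_ ?_
    · have := col_root (L := L) hΔ cc hud hua hub huc (by simp; grind) ∅ (by simp) [] (by simp) (by simp)
      simp at this; omega
    · have := col_root (L := L) hΔ cc huc hua hub hud (by simp; grind) {s(v, a), s(v, b)} (by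
        simp only [Finset.mem_insert, Finset.mem_singleton, forall_eq_or_imp, forall_eq]
        exact ⟨⟨hva, v, mem_W.2 (Or.inr ⟨huv.symm, hvc.symm⟩), a, mem_W.2 (Or.inl ⟨hac, hua⟩), hva.ne, by simp, by simp⟩,
          ⟨hvb, v, mem_W.2 (Or.inr ⟨huv.symm, hvc.symm⟩), b, mem_W.2 (Or.inl ⟨hbc, hub⟩), hvb.ne, by simp, by simp⟩⟩)
        [] (by simp) (by simp)
      rw [Finset.card_pair (by simp; grind)] at this
      simp at this; omega
    · have := col_root (L := L) hΔ cc hub hua huc hud (by simp; grind) {s(v, a), s(v, c)} (by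
        simp only [Finset.mem_insert, Finset.mem_singleton, forall_eq_or_imp, forall_eq]
        exact ⟨⟨hva, v, mem_W.2 (Or.inr ⟨huv.symm, hvb.symm⟩), a, mem_W.2 (Or.inl ⟨hab, hua⟩), hva.ne, by simp, by simp⟩,
          ⟨hvc, v, mem_W.2 (Or.inr ⟨huv.symm, hvb.symm⟩), c, mem_W.2 (Or.inl ⟨hbc.symm, huc⟩), hvc.ne, by simp, by simp⟩⟩)
        [] (by simp) (by simp)
      rw [Finset.card_pair (by simp; grind)] at this
      simp at this; omega
    · omega
  have key : ∀ t b' , t ≠ u → t ≠ v → G.Adj a t → (b' = b ∨ b' = c) → G.Adj b' t → 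
      ∃ P c0, Valid G L P c0 ∧ (∀ v, ∀ e ∈ P, ∀ f ∈ P, v ∈ e → v ∈ f → e = f) ∧
      P ⊆ nonr G u ∧ ∀ c, Valid G L (nonr G u) c → (∀ e ∈ P, c e = c0 e) →
        col G L c (nonr G u) s(u, a) ≤ 18 := by
    intro t b' htu htv hat hb' hbt
    have hub' : G.Adj u b' := by rcases hb' with rfl | rfl <;> assumption
    refine ⟨∅, fun _ => 0, empty_valid, by simp, by simp, fun cc _ _ => ?_⟩
    have := col_root (L := L) hΔ cc hua hub huc hud hn {s(v, b), s(v, c), s(t, b')} (by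
        simp only [Finset.mem_insert, Finset.mem_singleton, forall_eq_or_imp, forall_eq]
        exact ⟨⟨hvb, v, mem_W.2 (Or.inr ⟨huv.symm, hva.symm⟩), b, mem_W.2 (Or.inl ⟨hab.symm, hub⟩), hvb.ne, by simp, by simp⟩,
          ⟨hvc, v, mem_W.2 (Or.inr ⟨huv.symm, hva.symm⟩), c, mem_W.2 (Or.inl ⟨hac.symm, huc⟩), hvc.ne, by simp, by simp⟩,
          ⟨hbt.symm, t, mem_W.2 (Or.inr ⟨htu, hat⟩), b', mem_W.2 (Or.inl ⟨by grind, hub'⟩), hbt.ne', by simp, by simp⟩⟩)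
        [] (by simp) (by simp)
    rw [Finset.card_eq_three.2 ⟨_, _, _, by simp; grind, by simp; grind, by simp; grind, rfl⟩] at this
    simp at this; omega
  -- one nonclose pair
  have key2 : ∀ a1 b' b1, G.Adj a a1 → a1 ≠ u → a1 ≠ v → (b' = b ∨ b' = c) → G.Adj b' b1 → b1 ≠ u → b1 ≠ v →
      ¬ G.Adj a1 b1 → 
      ∃ P c0, Valid G L P c0 ∧ (∀ v, ∀ e ∈ P, ∀ f ∈ P, v ∈ e → v ∈ f → e = f) ∧
      P ⊆ nonr G u ∧ ∀ c, Valid G L (nonr G u) c → (∀ e ∈ P, c e = c0 e) →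
        col G L c (nonr G u) s(u, a) ≤ 18 := by
    intro a1 b' b1 haa1 ha1u ha1v hb' hbb1 hb1u hb1v hnon
    by_cases hk : G.Adj b' a1
    · exact key a1 b' ha1u ha1v haa1 hb' hk
    by_cases hk' : G.Adj a b1
    · exact key b1 b' hb1u hb1v hk' hb' hbb1
    have hub' : G.Adj u b' := by rcases hb' with rfl | rfl <;> assumption
    have hab' : a ≠ b' := by grind
    have hncl : ¬ EdgeClose G s(a, a1) s(b', b1) := by
      rw [close_iff]
      have := tri u a b' hua
      have := tri u b' a
      grind [SimpleGraph.adj_comm]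
    have hne : s(a, a1) ≠ s(b', b1) := by
      intro h
      apply hncl
      rw [h]
      exact ⟨b', b', by simp, by simp, Or.inl rfl⟩
    obtain ⟨c0, hc0, -, hgain⟩ := ext_pair hL (empty_valid (G := G) (L := L)) (x := s(a, a1)) (y := s(b', b1)) haa1 hbb1
      (by simp) (by simp) hne hncl {s(u, a)} (by simpa using hua) (by simp)
    refine ⟨_, c0, hc0, ?_, ?_, ?_⟩
    · intro w e he f hf hwe hwf
      simp only [Finset.mem_insert, Finset.notMem_empty, or_false] at he hf
      rcases he with rfl | rfl <;> rcases hf with rfl | rfl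
      · rfl
      · exact absurd ⟨w, w, hwe, hwf, Or.inl rfl⟩ hncl
      · exact absurd ⟨w, w, hwf, hwe, Or.inl rfl⟩ hncl
      · rfl
    · intro e he
      simp only [Finset.mem_insert, Finset.notMem_empty, or_false] at he
      rcases he with rfl | rfl <;> rw [mem_nonr]
      · exact ⟨haa1, by simp [hua.ne, ha1u.symm]⟩
      · exact ⟨hbb1, by simp [hub'.ne, hb1u.symm]⟩
    · intro cc hcc hag
      have := col_root (L := L) hΔ cc hua hub huc hud hn {s(v, b), s(v, c)} (by
        simp only [Finset.mem_insert, Finset.mem_singleton, forall_eq_or_imp, forall_eq]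
        exact ⟨⟨hvb, v, mem_W.2 (Or.inr ⟨huv.symm, hva.symm⟩), b, mem_W.2 (Or.inl ⟨hab.symm, hub⟩), hvb.ne, by simp, by simp⟩,
          ⟨hvc, v, mem_W.2 (Or.inr ⟨huv.symm, hva.symm⟩), c, mem_W.2 (Or.inl ⟨hac.symm, huc⟩), hvc.ne, by simp, by simp⟩⟩)
        [(s(a, a1), s(b', b1))] (by simpa using hne) (by
          simp only [List.mem_singleton, forall_eq]
          refine ⟨mem_KT haa1 hua.ne' ha1u (by simp), mem_KT hbb1 hub'.ne' hb1u (by simp [hub']), ?_⟩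
          exact Gain_congr (hgain _ (by simp)) (hag _ (by simp)) (hag _ (by simp)))
      rw [Finset.card_pair (by simp; grind)] at this
      simp at this; omega
  rcases hx with hx | ⟨t, t1, t2, t3, t4⟩
  swap; · exact key t b t1 t2 t3 (by simp) t4
  obtain ⟨a1, a2, hna, hNa⟩ := nbrs2 (h4 a) hua.symm hva.symm huv
  obtain ⟨b1, b2, hnb, hNb⟩ := nbrs2 (h4 b) hub.symm hvb.symm huv
  obtain ⟨c1, c2, hnc, hNc⟩ := nbrs2 (h4 c) huc.symm hvc.symm huv
  simp only [List.nodup_cons, List.mem_cons, List.not_mem_nil, not_or] at hna hnb hnc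
  have ha1 : G.Adj a a1 := by simp [hNa]
  have hb1 : G.Adj b b1 := by simp [hNb]
  have hb2 : G.Adj b b2 := by simp [hNb]
  have hc1 : G.Adj c c1 := by simp [hNc]
  have hc2 : G.Adj c c2 := by simp [hNc]
  by_cases e1 : G.Adj a1 b1
  swap; · exact key2 a1 b b1 ha1 (by grind) (by grind) (by simp) hb1 (by grind) (by grind) e1
  by_cases e2 : G.Adj a1 b2
  swap; · exact key2 a1 b b2 ha1 (by grind) (by grind) (by simp) hb2 (by grind) (by grind) e2
  by_cases e3 : G.Adj a1 c1
  swap; · exact key2 a1 c c1 ha1 (by grind) (by grind) (by simp) hc1 (by grind) (by grind) e3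
  by_cases e4 : G.Adj a1 c2
  swap; · exact key2 a1 c c2 ha1 (by grind) (by grind) (by simp) hc2 (by grind) (by grind) e4
  exfalso
  have hx1 := hx b1 (by grind) (by grind) hb1
  have hx2 := hx b2 (by grind) (by grind) hb2
  have nab : ¬ G.Adj a b := tri a u b hua.symm hub
  have nac : ¬ G.Adj a c := tri a u c hua.symm huc
  have hcard : ({a, b1, b2, c1, c2} : Finset V).card = 5 := by
    rw [Finset.card_insert_of_notMem, Finset.card_insert_of_notMem, Finset.card_insert_of_notMem,
      Finset.card_pair]
    all_goals (try simp only [Finset.mem_insert, Finset.mem_singleton, not_or])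
    all_goals grind [SimpleGraph.adj_comm]
  have hsub : ({a, b1, b2, c1, c2} : Finset V) ⊆ G.neighborFinset a1 := by
    intro x hx
    simp only [Finset.mem_insert, Finset.mem_singleton] at hx
    rw [SimpleGraph.mem_neighborFinset]
    rcases hx with rfl | rfl | rfl | rfl | rfl
    · exact ha1.symm
    all_goals assumption
  have h5 := Finset.card_le_card hsub
  rw [hcard, SimpleGraph.card_neighborFinset_eq_degree] at h5
  have := hΔ a1
  omega

theorem case_K23 (hconn : G.Connected) (hΔ : ∀ u, G.degree u ≤ 4)
    (hL : ∀ e ∈ G.edgeSet, (L e).card = 22) (h4 : ∀ u, G.degree u = 4)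
    (tri : ∀ a b c, G.Adj a b → G.Adj b c → ¬ G.Adj a c) {u v a b c : V} (huv : u ≠ v)
    (hua : G.Adj u a) (hub : G.Adj u b) (huc : G.Adj u c)
    (hva : G.Adj v a) (hvb : G.Adj v b) (hvc : G.Adj v c) (hab : a ≠ b) (hac : a ≠ c)
    (hbc : b ≠ c) : StronglyLColorable G L := by
  by_cases h : ∃ t, t ≠ u ∧ t ≠ v ∧ G.Adj b t ∧ G.Adj c t
  · exact case_K23_aux hconn hΔ hL h4 tri huv hub huc hua hvb hvc hva hbc hab.symm hac.symm
      (Or.inr h)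
  · exact case_K23_aux hconn hΔ hL h4 tri huv hua hub huc hva hvb hvc hab hac hbc
      (Or.inl (fun t h1 h2 h3 h5 => h ⟨t, h1, h2, h3, h5⟩))

theorem match_nodup : ∀ l : List (V × V), (l.flatMap (fun p => [p.1, p.2])).Nodup →
    ∀ v, ∀ p ∈ l, ∀ q ∈ l, v ∈ s(p.1, p.2) → v ∈ s(q.1, q.2) → p = q := by
  intro l
  induction l with
  | nil => simp
  | cons a l ih =>
    intro h v p hp' q hq' hvp hvq
    simp only [List.flatMap_cons, List.cons_append, List.nil_append, List.nodup_cons,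
      List.mem_cons, not_or] at h
    obtain ⟨⟨_, h1⟩, h2, h3⟩ := h
    have hx : ∀ w, w ∈ s(a.1, a.2) → ∀ q ∈ l, w ∉ s(q.1, q.2) := by
      intro w hw q hq hwq
      have : w ∈ l.flatMap (fun p => [p.1, p.2]) :=
        List.mem_flatMap.2 ⟨q, hq, by simpa using hwq⟩
      rcases Sym2.mem_iff.1 hw with rfl | rfl
      · exact h1 this
      · exact h2 this
    rcases List.mem_cons.1 hp' with hpa | hp <;> rcases List.mem_cons.1 hq' with hqa | hq
    · rw [hpa, hqa]
    · rw [hpa] at hvp; exact absurd hvq (hx v hvp q hq)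
    · rw [hqa] at hvq; exact absurd hvp (hx v hvq p hp)
    · exact ih h3 v p hp q hq hvp hvq

theorem match_P (P : Finset (Sym2 V)) (l : List (V × V))
    (hl : (l.flatMap (fun p => [p.1, p.2])).Nodup)
    (hP : ∀ e ∈ P, ∃ p ∈ l, e = s(p.1, p.2)) :
    ∀ v, ∀ e ∈ P, ∀ f ∈ P, v ∈ e → v ∈ f → e = f := by
  intro v e he f hf hve hvf
  obtain ⟨p, hp, rfl⟩ := hP e he
  obtain ⟨q, hq, rfl⟩ := hP f hf
  rw [match_nodup l hl v p hp q hq hve hvf]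


theorem nodup_edges : ∀ l : List (V × V), (l.flatMap (fun p => [p.1, p.2])).Nodup →
    (l.map (fun p => s(p.1, p.2))).Nodup := by
  intro l
  induction l with
  | nil => simp
  | cons a l ih =>
    intro h
    simp only [List.flatMap_cons, List.cons_append, List.nil_append, List.nodup_cons,
      List.mem_cons, not_or] at h
    obtain ⟨⟨_, h1⟩, h2, h3⟩ := h
    rw [List.map_cons, List.nodup_cons]
    refine ⟨fun hm => ?_, ih h3⟩
    obtain ⟨q, hq, he⟩ := List.mem_map.1 hm
    have h4 : a.1 ∈ s(q.1, q.2) := by rw [he]; simp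
    exact h1 (List.mem_flatMap.2 ⟨q, hq, by simpa using h4⟩)

set_option maxHeartbeats 2000000 in
theorem case_g5 (hconn : G.Connected) (hΔ : ∀ u, G.degree u ≤ 4)
    (hL : ∀ e ∈ G.edgeSet, (L e).card = 22) (h4 : ∀ u, G.degree u = 4)
    (tri : ∀ a b c, G.Adj a b → G.Adj b c → ¬ G.Adj a c)
    (c4 : ∀ u v x y, u ≠ v → G.Adj u x → G.Adj v x → G.Adj u y → G.Adj v y → x = y) (r : V) :
    StronglyLColorable G L := by
  obtain ⟨n1, n2, n3, n4, hn, hN⟩ := nbrs0 (h4 r)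
  have a1 : G.Adj r n1 := by simp [hN]
  have a2 : G.Adj r n2 := by simp [hN]
  have a3 : G.Adj r n3 := by simp [hN]
  have a4 : G.Adj r n4 := by simp [hN]
  have hn' := hn
  simp only [List.nodup_cons, List.mem_cons, List.not_mem_nil, not_or] at hn'
  obtain ⟨⟨n12, n13, n14, -⟩, ⟨n23, n24, -⟩, ⟨n34, -⟩, -⟩ := hn'
  obtain ⟨x1, b, g, hn1, hN1⟩ := nbrs1 (h4 n1) a1.symm
  simp only [List.nodup_cons, List.mem_cons, List.not_mem_nil, not_or] at hn1
  obtain ⟨⟨rx1, rb, rg, -⟩, ⟨x1b, x1g, -⟩, ⟨bg, -⟩, -⟩ := hn1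
  have ax1 : G.Adj n1 x1 := by simp [hN1]
  have ab : G.Adj n1 b := by simp [hN1]
  have ag : G.Adj n1 g := by simp [hN1]
  clear hN1
  -- basic nonadjacency
  have fr : ∀ n x, G.Adj r n → G.Adj n x → ¬ G.Adj r x := fun n x h1 h2 => tri r n x h1 h2
  have f2 : ∀ n m x, G.Adj r n → G.Adj r m → n ≠ m → G.Adj n x → r ≠ x → ¬ G.Adj m x :=
    fun n m x h1 h2 h3 h4 h5 h6 => h5 (c4 n m r x h3 h1.symm h2.symm h4 h6)
  have hbg : ¬ G.Adj b g := tri b n1 g ab.symm ag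
  have hbx1 : ¬ G.Adj b x1 := tri b n1 x1 ab.symm ax1
  have hgx1 : ¬ G.Adj g x1 := tri g n1 x1 ag.symm ax1
  have nb4 : b ≠ n4 := by rintro rfl; exact fr _ _ a1 ab a4
  have ng2 : g ≠ n2 := by rintro rfl; exact fr _ _ a1 ag a2
  obtain ⟨b', ab', b'n1, b'n4, -⟩ := pick (h4 b) (fun y => y = n1) (fun y => G.Adj n4 y)
    (fun y => False) (by grind) (fun u v hu hv h1 h2 => c4 b n4 u v nb4 hu h1 hv h2) (by simp)
  have gb' : g ≠ b' := by rintro rfl; exact hbg ab'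
  obtain ⟨g', ag', g'n1, g'n2, g'b'⟩ := pick (h4 g) (fun y => y = n1) (fun y => G.Adj n2 y)
    (fun y => G.Adj b' y) (by grind) (fun u v hu hv h1 h2 => c4 g n2 u v ng2 hu h1 hv h2)
    (fun u v hu hv h1 h2 => c4 g b' u v gb' hu h1 hv h2)
  have nx12 : n2 ≠ x1 := by rintro rfl; exact fr _ _ a1 ax1 a2
  obtain ⟨x2, ax2, x2r, x2b', x2x1⟩ := pick (h4 n2) (fun y => y = r) (fun y => y = b')
    (fun y => G.Adj x1 y) (by grind) (by grind)
    (fun u v hu hv h1 h2 => c4 n2 x1 u v nx12 hu h1 hv h2)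
  obtain ⟨x3, ax3, x3r, x3b', x3g'⟩ := pick (h4 n3) (fun y => y = r) (fun y => y = b')
    (fun y => y = g') (by grind) (by grind) (by grind)
  have nx34 : n4 ≠ x3 := by rintro rfl; exact fr _ _ a3 ax3 a4
  obtain ⟨x4, ax4, x4r, x4g', x4x3⟩ := pick (h4 n4) (fun y => y = r) (fun y => y = g')
    (fun y => G.Adj x3 y) (by grind) (by grind)
    (fun u v hu hv h1 h2 => c4 n4 x3 u v nx34 hu h1 hv h2)
  have x2r' := Ne.symm x2r
  have x3r' := Ne.symm x3r
  have x4r' := Ne.symm x4r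
  have rx1' := fr _ _ a1 ax1
  have rb' := fr _ _ a1 ab
  have rg' := fr _ _ a1 ag
  have rx2' := fr _ _ a2 ax2
  have rx3' := fr _ _ a3 ax3
  have rx4' := fr _ _ a4 ax4
  have q1 := f2 _ _ _ a1 a2 n12 ax1 rx1
  have q2 := f2 _ _ _ a1 a3 n13 ax1 rx1
  have q3 := f2 _ _ _ a1 a4 n14 ax1 rx1
  have q4 := f2 _ _ _ a1 a2 n12 ab rb
  have q5 := f2 _ _ _ a1 a3 n13 ab rb
  have q6 := f2 _ _ _ a1 a4 n14 ab rb
  have q7 := f2 _ _ _ a1 a2 n12 ag rg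
  have q8 := f2 _ _ _ a1 a3 n13 ag rg
  have q9 := f2 _ _ _ a1 a4 n14 ag rg
  have q10 := f2 _ _ _ a2 a1 (Ne.symm n12) ax2 x2r'
  have q11 := f2 _ _ _ a2 a3 n23 ax2 x2r'
  have q12 := f2 _ _ _ a2 a4 n24 ax2 x2r'
  have q13 := f2 _ _ _ a3 a1 (Ne.symm n13) ax3 x3r'
  have q14 := f2 _ _ _ a3 a2 (Ne.symm n23) ax3 x3r'
  have q15 := f2 _ _ _ a3 a4 n34 ax3 x3r'
  have q16 := f2 _ _ _ a4 a1 (Ne.symm n14) ax4 x4r'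
  have q17 := f2 _ _ _ a4 a2 (Ne.symm n24) ax4 x4r'
  have q18 := f2 _ _ _ a4 a3 (Ne.symm n34) ax4 x4r'
  have s1 : ¬ G.Adj b r := fun h => rb' h.symm
  have s2 : ¬ G.Adj b n2 := fun h => q4 h.symm
  have s3 : ¬ G.Adj b n3 := fun h => q5 h.symm
  have s4 : ¬ G.Adj b n4 := fun h => q6 h.symm
  have t1 : ¬ G.Adj g r := fun h => rg' h.symm
  have t2 : ¬ G.Adj g n2 := fun h => q7 h.symm
  have t3 : ¬ G.Adj g n3 := fun h => q8 h.symm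
  have t4 : ¬ G.Adj g n4 := fun h => q9 h.symm
  have hgb : ¬ G.Adj g b := fun h => hbg h.symm
  have u1 : ¬ G.Adj b g' := fun h => g'n1 (c4 b g g' n1 bg h ag' ab.symm ag.symm)
  have u2 : ¬ G.Adj g b' := fun h => b'n1 (c4 b g b' n1 bg ab' h ab.symm ag.symm)
  have b'r : b' ≠ r := by rintro rfl; exact s1 ab'
  have g'r : g' ≠ r := by rintro rfl; exact t1 ag'
  have hnd : ([(n1, x1), (n2, x2), (n3, x3), (n4, x4), (b, b'), (g, g')].flatMap
      (fun p : V × V => [p.1, p.2])).Nodup := by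
    clear hN tri c4 fr f2 h4 hΔ hL hn
    simp only [List.flatMap_cons, List.flatMap_nil, List.cons_append, List.nil_append,
      List.nodup_cons, List.mem_cons, List.not_mem_nil, not_or, or_false, not_false_eq_true,
      List.nodup_nil, and_true]
    have e1 := ax1.ne
    have e2 := ax2.ne
    have e3 := ax3.ne
    have e4 := ax4.ne
    have e5 := ab'.ne
    have e6 := ag'.ne
    have e7 := ab.ne
    have e8 := ag.ne
    and_intros <;> (intro hh; subst hh; first | contradiction | simp_all)
  have hncl1 : ¬ EdgeClose G s(n1, x1) s(n2, x2) := by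
    rw [close_iff]
    rintro ((h | h) | (h | h) | (h | h) | (h | h))
    · exact n12 h
    · exact tri n1 r n2 a1.symm a2 h
    · exact rx2' (h ▸ a1)
    · exact q10 h
    · exact nx12 h.symm
    · exact q1 h.symm
    · exact q1 (h ▸ ax2)
    · exact x2x1 h
  have hncl2 : ¬ EdgeClose G s(n3, x3) s(n4, x4) := by
    rw [close_iff]
    rintro ((h | h) | (h | h) | (h | h) | (h | h))
    · exact n34 h
    · exact tri n3 r n4 a3.symm a4 h
    · exact rx4' (h ▸ a3)
    · exact q18 h
    · exact nx34 h.symm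
    · exact q15 h.symm
    · exact q15 (h ▸ ax4)
    · exact x4x3 h
  have hncl3 : ¬ EdgeClose G s(b, b') s(g, g') := by
    rw [close_iff]
    rintro ((h | h) | (h | h) | (h | h) | (h | h))
    · exact bg h
    · exact hbg h
    · exact hgb (h ▸ ag')
    · exact u1 h
    · exact gb' h.symm
    · exact u2 h.symm
    · exact u1 (h ▸ ab')
    · exact g'b' h
  have hnde : [s(n1, x1), s(n2, x2), s(n3, x3), s(n4, x4), s(b, b'), s(g, g')].Nodup := nodup_edges _ hnd
  have hnd6 := hnde
  simp only [List.nodup_cons, List.mem_cons, List.not_mem_nil, not_or] at hnde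
  obtain ⟨⟨k12, k13, k14, k15, k16, -⟩, ⟨k23, k24, k25, k26, -⟩, ⟨k34, k35, k36, -⟩,
    ⟨k45, k46, -⟩, ⟨k56, -⟩, -⟩ := hnde
  obtain ⟨c1, v1, -, g1⟩ := ext_pair hL (empty_valid (G := G) (L := L)) ax1 ax2
    (by simp) (by simp) k12 hncl1 {s(r, n1), s(r, n2), s(r, n3)} (by simp [a1, a2, a3])
    (lt_of_le_of_lt (Nat.mul_le_mul_left _ Finset.card_le_three) (by simp))
  have hc2 : (insert s(n1, x1) (insert s(n2, x2) ∅) : Finset (Sym2 V)).card = 2 :=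
    Finset.card_pair k12
  obtain ⟨c2, v2, ag2, g2⟩ := ext_pair hL v1 ax3 ax4
    (by simp [-Sym2.eq]; exact ⟨Ne.symm k13, Ne.symm k23⟩)
    (by simp [-Sym2.eq]; exact ⟨Ne.symm k14, Ne.symm k24⟩) k34 hncl2 {s(r, n1), s(r, n2), s(r, n3)} (by simp [a1, a2, a3])
    (lt_of_le_of_lt (Nat.mul_le_mul_left _ Finset.card_le_three) (by rw [hc2]; norm_num))
  have hc4 : (insert s(n3, x3) (insert s(n4, x4) (insert s(n1, x1) (insert s(n2, x2) ∅))) : Finset (Sym2 V)).card ≤ 4 := by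
    refine (Finset.card_insert_le _ _).trans ?_
    have := Finset.card_insert_le s(n4, x4) (insert s(n1, x1) (insert s(n2, x2) ∅) : Finset (Sym2 V))
    omega
  obtain ⟨c3, v3, ag3, g3⟩ := ext_pair hL v2 ab' ag'
    (by simp [-Sym2.eq]; exact ⟨Ne.symm k35, Ne.symm k45, Ne.symm k15, Ne.symm k25⟩)
    (by simp [-Sym2.eq]; exact ⟨Ne.symm k36, Ne.symm k46, Ne.symm k16, Ne.symm k26⟩) k56 hncl3 {s(r, n1)} (by simp [a1])
    (by
      have : 18 ≤ 22 - (insert s(n3, x3) (insert s(n4, x4) (insert s(n1, x1) (insert s(n2, x2) ∅))) : Finset (Sym2 V)).card := by omega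
      have := Nat.mul_le_mul this this
      simp only [Finset.card_singleton]
      omega)
  obtain ⟨c, hc, hag⟩ := main hconn hΔ hL r _ c3 v3 (match_P _ _ hnd (by
    intro e he
    simp only [Finset.mem_insert, Finset.notMem_empty, or_false] at he
    rcases he with rfl | rfl | rfl | rfl | rfl | rfl
    · exact ⟨(b, b'), by simp, rfl⟩
    · exact ⟨(g, g'), by simp, rfl⟩
    · exact ⟨(n3, x3), by simp, rfl⟩
    · exact ⟨(n4, x4), by simp, rfl⟩
    · exact ⟨(n1, x1), by simp, rfl⟩
    · exact ⟨(n2, x2), by simp, rfl⟩))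
  rw [Finset.union_eq_right.2 (by
    intro e he
    simp only [Finset.mem_insert, Finset.notMem_empty, or_false] at he
    rcases he with rfl | rfl | rfl | rfl | rfl | rfl <;> rw [mem_nonr, SimpleGraph.mem_edgeSet, Sym2.mem_iff, not_or]
    · exact ⟨ab', rb, b'r.symm⟩
    · exact ⟨ag', rg, g'r.symm⟩
    · exact ⟨ax3, a3.ne, x3r'⟩
    · exact ⟨ax4, a4.ne, x4r'⟩
    · exact ⟨ax1, a1.ne, rx1⟩
    · exact ⟨ax2, a2.ne, x2r'⟩)] at hc
  have G1 : ∀ z ∈ ({s(r, n1), s(r, n2), s(r, n3)} : Finset (Sym2 V)), Gain L c z s(n1, x1) s(n2, x2) := by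
    intro z hz
    refine Gain_congr (g1 z hz) ?_ ?_
    · rw [hag _ (by simp), ag3 _ (by simp), ag2 _ (by simp)]
    · rw [hag _ (by simp), ag3 _ (by simp), ag2 _ (by simp)]
  have G2 : ∀ z ∈ ({s(r, n1), s(r, n2), s(r, n3)} : Finset (Sym2 V)), Gain L c z s(n3, x3) s(n4, x4) := by
    intro z hz
    refine Gain_congr (g2 z hz) ?_ ?_
    · rw [hag _ (by simp), ag3 _ (by simp)]
    · rw [hag _ (by simp), ag3 _ (by simp)]
  have G3 : Gain L c s(r, n1) s(b, b') s(g, g') :=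
    Gain_congr (g3 _ (by simp)) (hag _ (by simp)) (hag _ (by simp))
  have m1 : ∀ n, s(n1, x1) ∈ nonr G r ∩ T G s(r, n) := fun n => mem_KT ax1 a1.ne' (Ne.symm rx1) (Or.inr (Or.inl a1))
  have m2 : ∀ n, s(n2, x2) ∈ nonr G r ∩ T G s(r, n) := fun n => mem_KT ax2 a2.ne' x2r (Or.inr (Or.inl a2))
  have m3 : ∀ n, s(n3, x3) ∈ nonr G r ∩ T G s(r, n) := fun n => mem_KT ax3 a3.ne' x3r (Or.inr (Or.inl a3))
  have m4 : ∀ n, s(n4, x4) ∈ nonr G r ∩ T G s(r, n) := fun n => mem_KT ax4 a4.ne' x4r (Or.inr (Or.inl a4))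
  have m5 : s(b, b') ∈ nonr G r ∩ T G s(r, n1) := mem_KT ab' (Ne.symm rb) b'r (Or.inr (Or.inr ab))
  have m6 : s(g, g') ∈ nonr G r ∩ T G s(r, n1) := mem_KT ag' (Ne.symm rg) g'r (Or.inr (Or.inr ag))
  have hnd4 : [s(n1, x1), s(n2, x2), s(n3, x3), s(n4, x4)].Nodup :=
    List.Nodup.sublist (List.sublist_append_left [s(n1, x1), s(n2, x2), s(n3, x3), s(n4, x4)]
      [s(b, b'), s(g, g')]) hnd6
  refine finish4 (n1 := n4) (n2 := n3) (n3 := n2) (n4 := n1) hL hc (by intro x; rw [hN]; tauto) ?_ ?_ ?_ ?_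
  · have := col_root (L := L) hΔ c a4 a1 a2 a3 (by simp; grind) ∅ (by simp) [] (by simp) (by simp)
    simp at this; omega
  · have := col_root (L := L) hΔ c a3 a1 a2 a4 (by simp; grind) ∅ (by simp)
      [(s(n1, x1), s(n2, x2)), (s(n3, x3), s(n4, x4))] hnd4 (by
        intro p hp
        simp only [List.mem_cons, List.not_mem_nil, or_false] at hp
        rcases hp with rfl | rfl
        · exact ⟨m1 _, m2 _, G1 _ (by simp)⟩
        · exact ⟨m3 _, m4 _, G2 _ (by simp)⟩)
    simp at this; omega
  · have := col_root (L := L) hΔ c a2 a1 a3 a4 (by simp; grind) ∅ (by simp)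
      [(s(n1, x1), s(n2, x2)), (s(n3, x3), s(n4, x4))] hnd4 (by
        intro p hp
        simp only [List.mem_cons, List.not_mem_nil, or_false] at hp
        rcases hp with rfl | rfl
        · exact ⟨m1 _, m2 _, G1 _ (by simp)⟩
        · exact ⟨m3 _, m4 _, G2 _ (by simp)⟩)
    simp at this; omega
  · have := col_root (L := L) hΔ c a1 a2 a3 a4 (by simp; grind) ∅ (by simp)
      [(s(n1, x1), s(n2, x2)), (s(n3, x3), s(n4, x4)), (s(b, b'), s(g, g'))] hnd6 (by
        intro p hp
        simp only [List.mem_cons, List.not_mem_nil, or_false] at hp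
        rcases hp with rfl | rfl | rfl
        · exact ⟨m1 _, m2 _, G1 _ (by simp)⟩
        · exact ⟨m3 _, m4 _, G2 _ (by simp)⟩
        · exact ⟨m5, m6, G3⟩)
    simp at this; omega

theorem two_non (tri : ∀ a b c, G.Adj a b → G.Adj b c → ¬ G.Adj a c)
    (k23 : ∀ u v a b c, u ≠ v → G.Adj u a → G.Adj u b → G.Adj u c → G.Adj v a → G.Adj v b →
      G.Adj v c → a ≠ b → a ≠ c → b ≠ c → False)
    {w x z x1 x2 z1 z2 : V} (hwx : G.Adj w x) (hwz : G.Adj w z) (h1 : G.Adj x x1)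
    (h2 : G.Adj x x2) (h3 : G.Adj z z1) (h4 : G.Adj z z2) (hx : x1 ≠ x2) (hz : z1 ≠ z2) :
    (¬ G.Adj x1 z1 ∨ ¬ G.Adj x1 z2) ∨ (¬ G.Adj x2 z1 ∨ ¬ G.Adj x2 z2) := by
  by_contra! hc
  obtain ⟨⟨e1, e2⟩, e3, e4⟩ := hc
  have hzx : ¬ G.Adj z x := tri z w x hwz.symm hwx
  refine k23 x1 x2 x z1 z2 hx h1.symm e1 e2 h2.symm e3 e4 ?_ ?_ hz
  · rintro rfl; exact hzx h3
  · rintro rfl; exact hzx h4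

theorem col_gen (hΔ : ∀ u, G.degree u ≤ 4) (c : Sym2 V → ℕ) {r n : V} (hn : G.Adj r n)
    (S Q D : Finset (Sym2 V)) (hQ : Q ⊆ T G s(r, n)) (hQS : Disjoint Q S)
    (hD : ∀ f ∈ D, f ∈ G.edgeSet ∧ ∃ a ∈ W G r n, ∃ b ∈ W G r n, a ≠ b ∧ a ∈ f ∧ b ∈ f)
    (gs : List (Sym2 V × Sym2 V)) (hgs : (gs.flatMap (fun p => [p.1, p.2])).Nodup)
    (hg : ∀ p ∈ gs, p.1 ∈ S ∩ T G s(r, n) ∧ p.2 ∈ S ∩ T G s(r, n) ∧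
      Gain L c s(r, n) p.1 p.2) :
    col G L c S s(r, n) + gs.length + D.card + Q.card ≤ 24 := by
  have h1 := K_card hQ hQS
  have h2 := T_bound4 hΔ hn D hD
  have h3 : col G L c S s(r, n) + gs.length ≤ _ := col_pairs c (L s(r, n)) gs _ hgs hg
  omega

set_option maxHeartbeats 2000000 in
theorem case_c4 (hconn : G.Connected) (hΔ : ∀ u, G.degree u ≤ 4)
    (hL : ∀ e ∈ G.edgeSet, (L e).card = 22) (h4 : ∀ u, G.degree u = 4)
    (tri : ∀ a b c, G.Adj a b → G.Adj b c → ¬ G.Adj a c)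
    (k23 : ∀ u v a b c, u ≠ v → G.Adj u a → G.Adj u b → G.Adj u c → G.Adj v a → G.Adj v b →
      G.Adj v c → a ≠ b → a ≠ c → b ≠ c → False)
    {w x y z : V} (wx : G.Adj w x) (yx : G.Adj y x) (yz : G.Adj y z) (wz : G.Adj w z)
    (hwy : w ≠ y) (hxz : x ≠ z) : StronglyLColorable G L := by
  obtain ⟨xk, zl, axk, azl, xkw, xky, zlw, zly, hA⟩ : ∃ xk zl, G.Adj x xk ∧ G.Adj z zl ∧
      xk ≠ w ∧ xk ≠ y ∧ zl ≠ w ∧ zl ≠ y ∧ ¬ G.Adj xk zl := by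
    obtain ⟨x1, x2, hn, hN⟩ := nbrs2 (h4 x) wx.symm yx.symm hwy
    obtain ⟨z1, z2, hn2, hN2⟩ := nbrs2 (h4 z) wz.symm yz.symm hwy
    simp only [List.nodup_cons, List.mem_cons, List.not_mem_nil, not_or] at hn hn2
    have p1 : G.Adj x x1 := by simp [hN]
    have p2 : G.Adj x x2 := by simp [hN]
    have p3 : G.Adj z z1 := by simp [hN2]
    have p4 : G.Adj z z2 := by simp [hN2]
    rcases two_non tri k23 wx wz p1 p2 p3 p4 (by grind) (by grind) with (h | h) | (h | h)
    · exact ⟨x1, z1, p1, p3, by grind, by grind, by grind, by grind, h⟩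
    · exact ⟨x1, z2, p1, p4, by grind, by grind, by grind, by grind, h⟩
    · exact ⟨x2, z1, p2, p3, by grind, by grind, by grind, by grind, h⟩
    · exact ⟨x2, z2, p2, p4, by grind, by grind, by grind, by grind, h⟩
  obtain ⟨wi, wa, yj, hn, hN, ayj, yjx, yjz, hB⟩ : ∃ wi wa yj, [x, z, wi, wa].Nodup ∧
      (∀ t, G.Adj w t ↔ t = x ∨ t = z ∨ t = wi ∨ t = wa) ∧ G.Adj y yj ∧ yj ≠ x ∧ yj ≠ z ∧
      ¬ G.Adj wi yj := by
    obtain ⟨w1, w2, hn, hN⟩ := nbrs2 (h4 w) wx wz hxz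
    obtain ⟨y1, y2, hn2, hN2⟩ := nbrs2 (h4 y) yx yz hxz
    simp only [List.nodup_cons, List.mem_cons, List.not_mem_nil, not_or] at hn hn2 ⊢
    have p1 : G.Adj w w1 := by simp [hN]
    have p2 : G.Adj w w2 := by simp [hN]
    have p3 : G.Adj y y1 := by simp [hN2]
    have p4 : G.Adj y y2 := by simp [hN2]
    have hN' : ∀ t, G.Adj w t ↔ t = x ∨ t = z ∨ t = w2 ∨ t = w1 := by intro t; rw [hN]; tauto
    rcases two_non tri k23 wx.symm yx.symm p1 p2 p3 p4 (by grind) (by grind) with (h | h) | (h | h)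
    · exact ⟨w1, w2, y1, by grind, hN, p3, by grind, by grind, h⟩
    · exact ⟨w1, w2, y2, by grind, hN, p4, by grind, by grind, h⟩
    · exact ⟨w2, w1, y1, by grind, hN', p3, by grind, by grind, h⟩
    · exact ⟨w2, w1, y2, by grind, hN', p4, by grind, by grind, h⟩
  have awi : G.Adj w wi := by simp [hN]
  have awa : G.Adj w wa := by simp [hN]
  simp only [List.nodup_cons, List.mem_cons, List.not_mem_nil, not_or] at hn
  obtain ⟨⟨-, xwi, xwa, -⟩, ⟨zwi, zwa, -⟩, ⟨wiwa, -⟩, -⟩ := hn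
  have nwy : ¬ G.Adj w y := tri w x y wx yx.symm
  have nxz : ¬ G.Adj x z := tri x w z wx.symm wz
  have f1 : ¬ G.Adj z xk := fun h => k23 x z w y xk hxz wx.symm yx.symm axk wz.symm yz.symm h
    hwy xkw.symm xky.symm
  have f2 : ¬ G.Adj x zl := fun h => k23 x z w y zl hxz wx.symm yx.symm h wz.symm yz.symm azl
    hwy zlw.symm zly.symm
  have f3 : ¬ G.Adj y wi := fun h => k23 w y x z wi hwy wx wz awi yx yz h hxz xwi zwi
  have f4 : ¬ G.Adj w yj := fun h => k23 w y x z yj hwy wx wz h yx yz ayj hxz yjx.symm yjz.symm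
  have f5 : ¬ G.Adj w xk := tri w x xk wx axk
  have f6 : ¬ G.Adj y xk := tri y x xk yx axk
  have f7 : ¬ G.Adj w zl := tri w z zl wz azl
  have f8 : ¬ G.Adj y zl := tri y z zl yz azl
  have f9 : wi ≠ y := by rintro rfl; exact nwy awi
  have f10 : yj ≠ w := by rintro rfl; exact nwy ayj.symm
  have f11 : xk ≠ z := by rintro rfl; exact nxz axk
  have f12 : zl ≠ x := by rintro rfl; exact nxz azl.symm
  have hnd : ([(x, xk), (z, zl), (w, wi), (y, yj)].flatMap
      (fun p : V × V => [p.1, p.2])).Nodup := by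
    clear hN tri k23 h4 hΔ hL
    simp only [List.flatMap_cons, List.flatMap_nil, List.cons_append, List.nil_append,
      List.nodup_cons, List.mem_cons, List.not_mem_nil, not_or, or_false, not_false_eq_true,
      List.nodup_nil, and_true]
    have e1 := axk.ne
    have e2 := azl.ne
    have e3 := awi.ne
    have e4 := ayj.ne
    have e5 := wx.ne
    have e6 := wz.ne
    have e7 := yx.ne
    have e8 := yz.ne
    and_intros <;> (intro hh; subst hh; first | contradiction | simp_all)
  have hnclA : ¬ EdgeClose G s(x, xk) s(z, zl) := by
    rw [close_iff]
    rintro ((h | h) | (h | h) | (h | h) | (h | h))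
    · exact hxz h
    · exact nxz h
    · exact f12 h.symm
    · exact f2 h
    · exact f11 h
    · exact f1 h.symm
    · exact f1 (h ▸ azl)
    · exact hA h
  have hnclB : ¬ EdgeClose G s(w, wi) s(y, yj) := by
    rw [close_iff]
    rintro ((h | h) | (h | h) | (h | h) | (h | h))
    · exact hwy h
    · exact nwy h
    · exact f10 h.symm
    · exact f4 h
    · exact f9 h
    · exact f3 h.symm
    · exact f3 (h ▸ ayj)
    · exact hB h
  have hnde : [s(x, xk), s(z, zl), s(w, wi), s(y, yj)].Nodup := nodup_edges _ hnd
  have hnd4 := hnde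
  simp only [List.nodup_cons, List.mem_cons, List.not_mem_nil, not_or] at hnde
  obtain ⟨⟨k12, k13, k14, -⟩, ⟨k23', k24, -⟩, ⟨k34, -⟩, -⟩ := hnde
  obtain ⟨c1, v1, -, g1⟩ := ext_pair hL (empty_valid (G := G) (L := L)) axk azl
    (by simp) (by simp) k12 hnclA {s(w, wa), s(w, z), s(w, x)} (by simp [awa, wz, wx])
    (lt_of_le_of_lt (Nat.mul_le_mul_left _ Finset.card_le_three) (by simp))
  have hc2 : (insert s(x, xk) (insert s(z, zl) ∅) : Finset (Sym2 V)).card = 2 :=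
    Finset.card_pair k12
  obtain ⟨c2, v2, ag2, g2⟩ := ext_pair hL v1 awi ayj
    (by simp [-Sym2.eq]; exact ⟨Ne.symm k13, Ne.symm k23'⟩)
    (by simp [-Sym2.eq]; exact ⟨Ne.symm k14, Ne.symm k24⟩) k34 hnclB {s(w, x)} (by simp [wx])
    (by rw [hc2]; simp)
  obtain ⟨c, hc, hag⟩ := main hconn hΔ hL w _ c2 v2 (match_P _ _ hnd (by
    intro e he
    simp only [Finset.mem_insert, Finset.notMem_empty, or_false] at he
    rcases he with rfl | rfl | rfl | rfl
    · exact ⟨(w, wi), by simp, rfl⟩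
    · exact ⟨(y, yj), by simp, rfl⟩
    · exact ⟨(x, xk), by simp, rfl⟩
    · exact ⟨(z, zl), by simp, rfl⟩))
  have G1 : ∀ e ∈ ({s(w, wa), s(w, z), s(w, x)} : Finset (Sym2 V)), Gain L c e s(x, xk) s(z, zl) := by
    intro e he
    refine Gain_congr (g1 e he) ?_ ?_
    · rw [hag _ (by simp), ag2 _ (by simp)]
    · rw [hag _ (by simp), ag2 _ (by simp)]
  have G2 : Gain L c s(w, x) s(w, wi) s(y, yj) :=
    Gain_congr (g2 _ (by simp)) (hag _ (by simp)) (hag _ (by simp))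
  set P : Finset (Sym2 V) := insert s(w, wi) (insert s(y, yj) (insert s(x, xk) (insert s(z, zl) ∅))) with hP
  have hnotS : ∀ t, G.Adj w t → t ≠ wi → s(w, t) ∉ P ∪ nonr G w := by
    intro t ht hti
    have hwt := ht.ne
    have := wx.ne
    have := wz.ne
    simp only [hP, Finset.mem_union, mem_nonr, Finset.mem_insert, Finset.notMem_empty, or_false,
      Sym2.eq_iff, not_or]
    refine ⟨⟨?_, ?_, ?_, ?_⟩, by simp⟩ <;> simp_all
    all_goals grind
  have hKm : ∀ n a b, G.Adj w n → G.Adj a b → a ≠ w → b ≠ w → (a = n ∨ G.Adj w a ∨ G.Adj n a) →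
      s(a, b) ∈ (P ∪ nonr G w) ∩ T G s(w, n) := by
    intro n a b _ h1 h2 h3 h5
    have := mem_KT h1 h2 h3 h5
    rw [Finset.mem_inter] at this ⊢
    exact ⟨Finset.mem_union_right _ this.1, this.2⟩
  have hQd : ∀ s t, G.Adj w s → s ≠ wi → G.Adj w t → t ≠ wi →
      Disjoint ({s(w, s), s(w, t)} : Finset (Sym2 V)) (P ∪ nonr G w) := by
    intro s t h1 h2 h3 h5
    rw [Finset.disjoint_left]
    intro f hf
    simp only [Finset.mem_insert, Finset.mem_singleton] at hf
    rcases hf with rfl | rfl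
    · exact hnotS _ h1 h2
    · exact hnotS _ h3 h5
  have hQT : ∀ n s t, G.Adj w n → G.Adj w s → s ≠ n → G.Adj w t → t ≠ n →
      ({s(w, s), s(w, t)} : Finset (Sym2 V)) ⊆ T G s(w, n) := by
    intro n s t h0 h1 h2 h3 h5 f hf
    simp only [Finset.mem_insert, Finset.mem_singleton] at hf
    rcases hf with rfl | rfl
    · exact root_T h0 h1 h2
    · exact root_T h0 h3 h5
  have hQc : ∀ s t, s ≠ t → ({s(w, s), s(w, t)} : Finset (Sym2 V)).card = 2 := by
    intro s t h
    exact Finset.card_pair (fun hh => h (Sym2.congr_right.1 hh))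
  have hnd2 : [s(x, xk), s(z, zl)].Nodup :=
    List.Nodup.sublist (List.sublist_append_left [s(x, xk), s(z, zl)] [s(w, wi), s(y, yj)]) hnd4
  have hgA : ∀ n, G.Adj w n → Gain L c s(w, n) s(x, xk) s(z, zl) →
      ∀ p ∈ [(s(x, xk), s(z, zl))], p.1 ∈ (P ∪ nonr G w) ∩ T G s(w, n) ∧
        p.2 ∈ (P ∪ nonr G w) ∩ T G s(w, n) ∧ Gain L c s(w, n) p.1 p.2 := by
    intro n hn hg p hp
    rw [List.mem_singleton] at hp
    subst hp
    exact ⟨hKm n x xk hn axk wx.ne' xkw (Or.inr (Or.inl wx)),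
      hKm n z zl hn azl wz.ne' zlw (Or.inr (Or.inl wz)), hg⟩
  have C1 : col G L c (P ∪ nonr G w) s(w, wa) + 0 < 22 := by
    have := col_gen (L := L) hΔ c awa (P ∪ nonr G w) {s(w, x), s(w, z)} ∅
      (hQT _ _ _ awa wx xwa wz zwa) (hQd _ _ wx xwi wz zwi) (by simp)
      [(s(x, xk), s(z, zl))] hnd2 (hgA _ awa (G1 _ (by simp)))
    rw [hQc _ _ hxz] at this
    simp at this; omega
  have C2 : col G L c (P ∪ nonr G w) s(w, z) + 1 < 22 := by
    have := col_gen (L := L) hΔ c wz (P ∪ nonr G w) {s(w, x), s(w, wa)} {s(x, y)}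
      (hQT _ _ _ wz wx hxz awa (Ne.symm zwa)) (hQd _ _ wx xwi awa (Ne.symm wiwa)) (by
        simp only [Finset.mem_singleton, forall_eq]
        exact ⟨yx.symm, x, mem_W.2 (Or.inl ⟨hxz, wx⟩), y, mem_W.2 (Or.inr ⟨hwy.symm, yz.symm⟩),
          yx.ne', by simp, by simp⟩)
      [(s(x, xk), s(z, zl))] hnd2 (hgA _ wz (G1 _ (by simp)))
    rw [hQc _ _ xwa] at this
    simp at this; omega
  have C3 : col G L c (P ∪ nonr G w) s(w, x) + 2 < 22 := by
    have := col_gen (L := L) hΔ c wx (P ∪ nonr G w) {s(w, z), s(w, wa)} {s(z, y)}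
      (hQT _ _ _ wx wz hxz.symm awa (Ne.symm xwa)) (hQd _ _ wz zwi awa (Ne.symm wiwa)) (by
        simp only [Finset.mem_singleton, forall_eq]
        exact ⟨yz.symm, z, mem_W.2 (Or.inl ⟨hxz.symm, wz⟩), y, mem_W.2 (Or.inr ⟨hwy.symm, yx.symm⟩),
          yz.ne', by simp, by simp⟩)
      [(s(x, xk), s(z, zl)), (s(w, wi), s(y, yj))] hnd4 (by
        intro p hp
        rw [List.mem_cons] at hp
        rcases hp with hp | hp
        · exact hgA _ wx (G1 _ (by simp)) p (by simp [hp])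
        · rw [List.mem_singleton] at hp
          subst hp
          refine ⟨?_, hKm x y yj wx ayj hwy.symm f10 (Or.inr (Or.inr yx.symm)), G2⟩
          exact Finset.mem_inter.2 ⟨Finset.mem_union_left _ (by simp [hP]), root_T wx awi (Ne.symm xwi)⟩)
    rw [hQc _ _ zwa] at this
    simp at this; omega
  obtain ⟨c', hc'⟩ := finish hL [s(w, wa), s(w, z), s(w, x)] _ c hc (by
    simp [awa, wz, wx]) (by
    intro i hi
    simp only [List.length_cons, List.length_nil] at hi
    interval_cases i
    · exact C1
    · exact C2
    · exact C3)
  refine done hc' ?_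
  intro e he
  by_cases hr : w ∈ e
  · obtain ⟨n, rfl⟩ := Sym2.mem_iff_exists.1 hr
    have hadj : G.Adj w n := he
    rw [hN] at hadj
    rcases hadj with rfl | rfl | rfl | rfl
    · simp
    · simp
    · simp [hP]
    · simp
  · exact Finset.mem_union_left _ (Finset.mem_union_right _ (mem_nonr.2 ⟨he, hr⟩))

theorem colorable22 (hconn : G.Connected) (hΔ : ∀ u, G.degree u ≤ 4)
    (hL : ∀ e ∈ G.edgeSet, (L e).card = 22) : StronglyLColorable G L := by
  by_contra hno
  have h4 : ∀ u, G.degree u = 4 := by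
    intro u
    by_contra h
    have := hΔ u
    exact hno (case_low hconn hΔ hL u (by omega))
  have tri : ∀ a b c, G.Adj a b → G.Adj b c → ¬ G.Adj a c :=
    fun a b c h1 h2 h3 => hno (case_tri hconn hΔ hL h4 h1 h3 h2)
  have k23 : ∀ u v a b c, u ≠ v → G.Adj u a → G.Adj u b → G.Adj u c → G.Adj v a → G.Adj v b →
      G.Adj v c → a ≠ b → a ≠ c → b ≠ c → False :=
    fun u v a b c h h1 h2 h3 h5 h6 h7 h8 h9 h10 =>
      hno (case_K23 hconn hΔ hL h4 tri h h1 h2 h3 h5 h6 h7 h8 h9 h10)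
  have c4 : ∀ u v x y, u ≠ v → G.Adj u x → G.Adj v x → G.Adj u y → G.Adj v y → x = y := by
    intro u v x y h h1 h2 h3 h5
    by_contra hxy
    exact hno (case_c4 hconn hΔ hL h4 tri k23 h1 h2 h5 h3 h hxy)
  obtain ⟨r⟩ := hconn.nonempty
  exact hno (case_g5 hconn hΔ hL h4 tri c4 r)

end

end SEC

/-- A minimal counterexample (for lists of size 22) among connected simple
graphs with maximum degree at most 4 has no cycle of length 5. -/
theorem minimal_counterexample_no_cycle
    {V : Type*} [Fintype V] (G : SimpleGraph V) [DecidableRel G.Adj]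
    (hconn : G.Connected) (hΔ : ∀ u, G.degree u ≤ 4)
    (L : Sym2 V → Finset ℕ) (hL : ∀ e ∈ G.edgeSet, 22 ≤ (L e).card)
    (hG : ¬ StronglyLColorable G L)
    (hmin : ∀ H : SimpleGraph V, H < G → StronglyLColorable H L) :
    ¬ ∃ (v : V) (p : G.Walk v v), p.IsCycle ∧ p.length = 5 := by
  classical
  exfalso
  apply hG
  have hex : ∀ e, ∃ A ⊆ L e, e ∈ G.edgeSet → A.card = 22 := by
    intro e
    by_cases he : e ∈ G.edgeSet
    · obtain ⟨A, hA, hc⟩ := Finset.exists_subset_card_eq (hL e he)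
      exact ⟨A, hA, fun _ => hc⟩
    · exact ⟨L e, subset_rfl, fun h => absurd h he⟩
  choose M hM hM2 using hex
  obtain ⟨c, h1, h2⟩ := SEC.colorable22 (L := M) hconn hΔ hM2
  exact ⟨c, h1, fun e he => hM e (h2 e he)⟩
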